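/- Let k ≥ 2 and let n_1 = n_1(p), …, n_k = n_k(p) be sequences of positive integers with min_i n_i > p + 1 for all p ≥ 1 and p/n_i → y_i ∈ (0, 1] as p → ∞ for each 1 ≤ i ≤ k; set n = n_1 + ⋯ + n_k. For each p, let {x_{ij} : 1 ≤ i ≤ k, 1 ≤ j ≤ n_i} be independent ℝ^p-valued random vectors, each with independent standard normal coordinates. Define x̄_i = (1/n_i)Σ_{j=1}^{n_i} x_{ij}, A_i = Σ_{j=1}^{n_i}(x_{ij} − x̄_i)(x_{ij} − x̄_i)ᵀ, A = A_1 + ⋯ + A_k, and Bartlett's modified likelihood ratio statistic Λ_n* = [∏_{i=1}^k det(A_i)^{(n_i−1)/2} / det(A)^{(n−k)/2}] · (n−k)^{(n−k)p/2} / ∏_{i=1}^k (n_i−1)^{(n_i−1)p/2}. Define μ_n = (1/4)[ (n−k)(2n − 2p − 2k − 1)·log(1 − p/(n−k)) − Σ_{i=1}^k (n_i−1)(2n_i − 2p − 3)·log(1 − p/(n_i−1)) ] and σ_n² = (1/2)[ log(1 − p/(n−k)) − Σ_{i=1}^k ((n_i−1)/(n−k))²·log(1 − p/(n_i−1)) ],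 which is strictly positive. Then (log Λ_n* − μ_n)/((n−k) σ_n) converges in distribution to the standard normal distribution N(0,1) as p → ∞. -/

import Mathlib

open Filter Topology MeasureTheory ProbabilityTheory Matrix

/-- The logarithm of Bartlett's modified likelihood ratio statistic for testing
equality of the covariance matrices of `k` `p`-variate normal distributions,
computed from the data array `ω`, where `ω (⟨i, j⟩, c)` is the `c`-th coordinate of
the `j`-th observation in group `i` (group `i` has `nn i` observations):
`Λ* = [∏_i det(A_i)^{(n_i−1)/2} / det(A)^{(n−k)/2}]
      · (n−k)^{(n−k)p/2} / ∏_i (n_i−1)^{(n_i−1)p/2}`. -/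
noncomputable def logBartlettStat (k p : ℕ) (nn : Fin k → ℕ)
    (ω : ((i : Fin k) × Fin (nn i)) × Fin p → ℝ) : ℝ :=
  let n : ℝ := ∑ i, (nn i : ℝ)
  let xbar : Fin k → Fin p → ℝ := fun i c => (∑ j, ω (⟨i, j⟩, c)) / (nn i)
  let A : Fin k → Matrix (Fin p) (Fin p) ℝ := fun i =>
    ∑ j, Matrix.vecMulVec (fun c => ω (⟨i, j⟩, c) - xbar i c)
      (fun c => ω (⟨i, j⟩, c) - xbar i c)
  Real.log ((∏ i, (A i).det ^ (((nn i : ℝ) - 1) / 2)) / (∑ i, A i).det ^ ((n - k) / 2)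
    * ((n - k) ^ ((n - k) * p / 2) / ∏ i, ((nn i : ℝ) - 1) ^ (((nn i : ℝ) - 1) * p / 2)))

theorem bl_mgf_tight (μ : ℕ → ProbabilityMeasure ℝ)
    (h : ∀ s : ℝ, Tendsto (fun n => ∫⁻ x, ENNReal.ofReal (Real.exp (s * x)) ∂(μ n : Measure ℝ)) atTop
      (𝓝 (ENNReal.ofReal (Real.exp (s ^ 2 / 2))))) :
    IsTightMeasureSet (Set.range (fun n => (μ n : Measure ℝ))) := by
  apply isTightMeasureSet_range_of_tendsto_limsup_measure_norm_gt
  have hb : ∀ r : ℝ, limsup (fun n => (μ n : Measure ℝ) {x | r < ‖x‖}) atTop ≤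
      ENNReal.ofReal (Real.exp (-r)) * (ENNReal.ofReal (Real.exp (1 ^ 2 / 2))
        + ENNReal.ofReal (Real.exp ((-1) ^ 2 / 2))) := by
    intro r
    have h1 : Tendsto (fun n => ENNReal.ofReal (Real.exp (-r)) *
        ((∫⁻ x, ENNReal.ofReal (Real.exp (1 * x)) ∂(μ n : Measure ℝ)) +
        ∫⁻ x, ENNReal.ofReal (Real.exp ((-1) * x)) ∂(μ n : Measure ℝ))) atTop (𝓝
        (ENNReal.ofReal (Real.exp (-r)) * (ENNReal.ofReal (Real.exp (1 ^ 2 / 2))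
        + ENNReal.ofReal (Real.exp ((-1) ^ 2 / 2))))) :=
      ENNReal.Tendsto.const_mul ((h 1).add (h (-1))) (Or.inr ENNReal.ofReal_ne_top)
    rw [← h1.limsup_eq]
    refine limsup_le_limsup (Eventually.of_forall fun n => ?_)
    change (μ n : Measure ℝ) {x | r < ‖x‖} ≤ ENNReal.ofReal (Real.exp (-r)) *
        ((∫⁻ x, ENNReal.ofReal (Real.exp (1 * x)) ∂(μ n : Measure ℝ)) +
        ∫⁻ x, ENNReal.ofReal (Real.exp ((-1) * x)) ∂(μ n : Measure ℝ))
    rw [← lintegral_add_left (by fun_prop), ← lintegral_const_mul _ (by fun_prop),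
      ← lintegral_indicator_one (measurableSet_lt measurable_const measurable_norm)]
    refine lintegral_mono fun x => ?_
    by_cases hx : r < ‖x‖
    · rw [Set.indicator_of_mem (by exact hx), ← ENNReal.ofReal_add (by positivity) (by positivity),
        ← ENNReal.ofReal_mul (by positivity), mul_add, ← Real.exp_add, ← Real.exp_add]
      simp only [Pi.one_apply]
      rw [← ENNReal.ofReal_one]
      apply ENNReal.ofReal_le_ofReal
      rw [Real.norm_eq_abs] at hx
      rcases lt_abs.1 hx with hx | hx
      · have := Real.add_one_le_exp (-r + 1 * x)
        have := Real.exp_pos (-r + -1 * x)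
        linarith
      · have := Real.add_one_le_exp (-r + -1 * x)
        have := Real.exp_pos (-r + 1 * x)
        linarith
    · rw [Set.indicator_of_notMem (by exact hx)]; exact bot_le
  refine tendsto_of_tendsto_of_tendsto_of_le_of_le tendsto_const_nhds ?_ (fun r => bot_le) hb
  have h0 : Tendsto (fun r : ℝ => ENNReal.ofReal (Real.exp (-r))) atTop (𝓝 0) := by
    rw [← ENNReal.ofReal_zero]
    exact ENNReal.tendsto_ofReal Real.tendsto_exp_neg_atTop_nhds_zero
  have := ENNReal.Tendsto.mul_const (b := (ENNReal.ofReal (Real.exp (1 ^ 2 / 2))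
        + ENNReal.ofReal (Real.exp ((-1) ^ 2 / 2)))) h0 (Or.inr (by finiteness))
  simpa using this

theorem bl_lintegral_limit (μ : ℕ → ProbabilityMeasure ℝ)
    (h : ∀ s : ℝ, Tendsto (fun n => ∫⁻ x, ENNReal.ofReal (Real.exp (s * x)) ∂(μ n : Measure ℝ)) atTop
      (𝓝 (ENNReal.ofReal (Real.exp (s ^ 2 / 2))))) (U : Filter ℕ) [U.NeBot] (hU : U ≤ atTop)
    (ν : ProbabilityMeasure ℝ) (hν : Tendsto μ U (𝓝 ν)) (s : ℝ) :
    ∫⁻ x, ENNReal.ofReal (Real.exp (s * x)) ∂(ν : Measure ℝ) = ENNReal.ofReal (Real.exp (s ^ 2 / 2)) := by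
  -- truncations
  let g : ℕ → BoundedContinuousFunction ℝ NNReal := fun M =>
    BoundedContinuousFunction.mkOfBound
      ⟨fun x => min (Real.toNNReal (Real.exp (s * x))) (M + 1 : ℕ), by fun_prop⟩ (2 * (M + 1 : ℕ)) (by
        intro x y
        rw [NNReal.dist_eq]
        have h1 : ((min (Real.toNNReal (Real.exp (s * x))) ((M + 1 : ℕ) : NNReal) : NNReal) : ℝ) ≤ (M + 1 : ℕ) := by
          exact_mod_cast min_le_right _ _
        have h2 : ((min (Real.toNNReal (Real.exp (s * y))) ((M + 1 : ℕ) : NNReal) : NNReal) : ℝ) ≤ (M + 1 : ℕ) := by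
          exact_mod_cast min_le_right _ _
        have h3 := NNReal.coe_nonneg (min (Real.toNNReal (Real.exp (s * x))) ((M + 1 : ℕ) : NNReal))
        have h4 := NNReal.coe_nonneg (min (Real.toNNReal (Real.exp (s * y))) ((M + 1 : ℕ) : NNReal))
        simp only [ContinuousMap.coe_mk]
        rw [abs_le]; constructor <;> linarith)
  have hg : ∀ M x, (g M x : ENNReal) = min (ENNReal.ofReal (Real.exp (s * x))) ((M + 1 : ℕ) : ENNReal) := by
    intro M x
    change ((min (Real.toNNReal (Real.exp (s * x))) ((M + 1 : ℕ) : NNReal) : NNReal) : ENNReal) = _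
    rw [ENNReal.coe_min]; simp [ENNReal.ofReal]
  have hlim : ∀ M, Tendsto (fun n => ∫⁻ x, g M x ∂(μ n : Measure ℝ)) U (𝓝 (∫⁻ x, g M x ∂(ν : Measure ℝ))) :=
    fun M => (ProbabilityMeasure.tendsto_iff_forall_lintegral_tendsto.1 hν) (g M)
  have hmct : ∫⁻ x, ENNReal.ofReal (Real.exp (s * x)) ∂(ν : Measure ℝ) = ⨆ M, ∫⁻ x, g M x ∂(ν : Measure ℝ) := by
    rw [← lintegral_iSup]
    · congr with x
      apply le_antisymm
      · obtain ⟨M, hM⟩ := exists_nat_ge (Real.exp (s * x))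
        refine le_iSup_of_le M ?_
        rw [hg, min_eq_left]
        rw [← ENNReal.ofReal_natCast]
        apply ENNReal.ofReal_le_ofReal
        push_cast; linarith
      · exact iSup_le fun M => by rw [hg]; exact min_le_left _ _
    · intro M
      exact (ENNReal.continuous_coe.measurable.comp (g M).continuous.measurable)
    · intro M M' hMM x
      simp only [hg]
      apply min_le_min_left
      exact_mod_cast Nat.succ_le_succ hMM
  rw [hmct]
  apply le_antisymm
  · refine iSup_le fun M => le_of_tendsto_of_tendsto (hlim M) ((h s).mono_left hU)
      (Eventually.of_forall fun n => lintegral_mono fun x => ?_)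
    rw [hg]; exact min_le_left _ _
  · -- lower bound
    have key : ∀ M : ℕ, ENNReal.ofReal (Real.exp (s ^ 2 / 2)) ≤ (⨆ M, ∫⁻ x, g M x ∂(ν : Measure ℝ)) +
        ENNReal.ofReal (1 / (M + 1 : ℕ)) * ENNReal.ofReal (Real.exp ((2 * s) ^ 2 / 2)) := by
      intro M
      refine le_trans ?_ (add_le_add_left (le_iSup _ M) _)
      refine le_of_tendsto_of_tendsto ((h s).mono_left hU) ((hlim M).add
        (ENNReal.Tendsto.const_mul ((h (2 * s)).mono_left hU) (Or.inr ENNReal.ofReal_ne_top)))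
        (Eventually.of_forall fun n => ?_)
      change _ ≤ (∫⁻ x, (g M x : ENNReal) ∂(μ n : Measure ℝ)) + ENNReal.ofReal (1 / (M + 1 : ℕ)) * _
      rw [← lintegral_const_mul _ (by fun_prop), ← lintegral_add_right _ (by fun_prop)]
      refine lintegral_mono fun x => ?_
      simp only [hg]
      rw [← ENNReal.ofReal_mul (by positivity)]
      rcases le_total (ENNReal.ofReal (Real.exp (s * x))) ((M + 1 : ℕ) : ENNReal) with hx | hx
      · rw [min_eq_left hx]; exact le_self_add
      · refine le_trans ?_ le_add_self
        apply ENNReal.ofReal_le_ofReal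
        rw [← ENNReal.ofReal_natCast, ENNReal.ofReal_le_ofReal_iff (by positivity)] at hx
        have : Real.exp (2 * s * x) = Real.exp (s * x) * Real.exp (s * x) := by
          rw [← Real.exp_add]; ring_nf
        rw [this, one_div, ← div_eq_inv_mul, le_div_iff₀ (by positivity)]
        gcongr
    have hl : Tendsto (fun M : ℕ => (⨆ M, ∫⁻ x, g M x ∂(ν : Measure ℝ)) +
        ENNReal.ofReal (1 / (M + 1 : ℕ)) * ENNReal.ofReal (Real.exp ((2 * s) ^ 2 / 2))) atTop
        (𝓝 ((⨆ M, ∫⁻ x, g M x ∂(ν : Measure ℝ)) + ENNReal.ofReal 0 * ENNReal.ofReal (Real.exp ((2 * s) ^ 2 / 2)))) := by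
      refine tendsto_const_nhds.add (ENNReal.Tendsto.mul_const (ENNReal.tendsto_ofReal ?_) (Or.inr ENNReal.ofReal_ne_top))
      simpa using tendsto_one_div_add_atTop_nhds_zero_nat (𝕜 := ℝ)
    have := ge_of_tendsto' hl key
    simpa using this

theorem bl_weak_of_mgf (μ : ℕ → ProbabilityMeasure ℝ)
    (h : ∀ s : ℝ, Tendsto (fun n => ∫⁻ x, ENNReal.ofReal (Real.exp (s * x)) ∂(μ n : Measure ℝ)) atTop
      (𝓝 (ENNReal.ofReal (Real.exp (s ^ 2 / 2))))) :
    Tendsto μ atTop (𝓝 ⟨gaussianReal 0 1, inferInstance⟩) := by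
  refine (Filter.tendsto_iff_ultrafilter _ _ _).2 fun U hU ↦ ?_
  have h_compact : IsCompact (closure (Set.range μ)) := by
    apply isCompact_closure_of_isTightMeasureSet
    have := bl_mgf_tight μ h
    refine this.subset ?_
    rintro _ ⟨m, ⟨n, rfl⟩, rfl⟩
    exact ⟨n, rfl⟩
  obtain ⟨μ', -, hμ' : Tendsto _ _ _⟩ := h_compact.ultrafilter_le_nhds (U.map μ)
    (.trans (by simp) (monotone_principal subset_closure))
  have hl := bl_lintegral_limit μ h U hU μ' hμ'
  suffices (μ' : Measure ℝ) = gaussianReal 0 1 by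
    have h2 : μ' = (⟨gaussianReal 0 1, inferInstance⟩ : ProbabilityMeasure ℝ) := Subtype.ext this
    rw [← h2]; exact hμ'
  have hint : ∀ s : ℝ, Integrable (fun x => Real.exp (s * x)) (μ' : Measure ℝ) := by
    intro s
    refine ⟨by fun_prop, ?_⟩
    rw [hasFiniteIntegral_iff_ofReal (Eventually.of_forall fun x => by positivity), hl s]
    exact ENNReal.ofReal_lt_top
  have hmgf : mgf id (μ' : Measure ℝ) = mgf id (gaussianReal 0 1) := by
    rw [mgf_id_gaussianReal]
    ext s
    rw [mgf]
    simp only [id]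
    rw [integral_eq_lintegral_of_nonneg_ae (Eventually.of_forall fun x => by positivity) (by fun_prop), hl s,
      ENNReal.toReal_ofReal (by positivity)]
    simp
  have hset : integrableExpSet id (μ' : Measure ℝ) = Set.univ := by
    ext s; simpa [integrableExpSet] using hint s
  apply Measure.ext_of_complexMGF_id_eq
  have := eqOn_complexMGF_of_mgf hmgf
  rw [hset] at this
  ext z
  exact this (by simp)

theorem bl_pi_gauss_density (ι : Type*) [Fintype ι] :
    (Measure.pi fun _ : ι => gaussianReal 0 1) =
      (volume : Measure (ι → ℝ)).withDensity (fun x => ENNReal.ofReal (∏ i, gaussianPDFReal 0 1 (x i))) := by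
  refine Measure.pi_eq fun s hs => ?_
  rw [withDensity_apply _ (MeasurableSet.univ_pi hs), volume_pi, Measure.restrict_pi_pi]
  rw [← ofReal_integral_eq_lintegral_ofReal]
  · rw [integral_fintype_prod_eq_prod (f := fun _ => gaussianPDFReal 0 1), ENNReal.ofReal_prod_of_nonneg]
    · refine Finset.prod_congr rfl fun i _ => ?_
      rw [ofReal_integral_eq_lintegral_ofReal, gaussianReal_of_var_ne_zero _ one_ne_zero,
        withDensity_apply _ (hs i)]
      · rfl
      · exact (integrable_gaussianPDFReal 0 1).restrict
      · exact Eventually.of_forall fun x => gaussianPDFReal_nonneg _ _ _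
    · intro i _
      exact integral_nonneg fun x => gaussianPDFReal_nonneg _ _ _
  · exact Integrable.fintype_prod (f := fun _ => gaussianPDFReal 0 1)
      fun i => (integrable_gaussianPDFReal 0 1).restrict
  · exact Eventually.of_forall fun x => Finset.prod_nonneg fun i _ => gaussianPDFReal_nonneg _ _ _

theorem bl_pi_pdf (d : ℕ) (x : EuclideanSpace ℝ (Fin d)) :
    ∏ i, gaussianPDFReal 0 1 (x i) = ((√(2 * Real.pi))⁻¹) ^ d * Real.exp (-‖x‖ ^ 2 / 2) := by
  simp only [gaussianPDFReal]
  rw [Finset.prod_mul_distrib, ← Real.exp_sum, EuclideanSpace.norm_sq_eq]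
  simp [Finset.sum_div, neg_div]

section
variable {E : Type*} [NormedAddCommGroup E] [InnerProductSpace ℝ E] [FiniteDimensional ℝ E]
  [MeasurableSpace E] [BorelSpace E]

theorem bl_lintegral_stdGaussian (f : E → ENNReal) (hf : Measurable f) :
    ∫⁻ x, f x ∂(stdGaussian E) = ∫⁻ x, f x * ENNReal.ofReal (((√(2 * Real.pi))⁻¹) ^ (Module.finrank ℝ E)
      * Real.exp (-‖x‖ ^ 2 / 2)) := by
  have h1 := stdGaussian_map (E := EuclideanSpace ℝ (Fin (Module.finrank ℝ E))) (F := E)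
    (stdOrthonormalBasis ℝ E).repr.symm
  have hm : Measurable ((stdOrthonormalBasis ℝ E).repr.symm) :=
    (stdOrthonormalBasis ℝ E).repr.symm.continuous.measurable
  have h2 := (stdOrthonormalBasis ℝ E).measurePreserving_repr_symm
  have hpm : AEMeasurable (fun x : Fin (Module.finrank ℝ E) → ℝ => ENNReal.ofReal (∏ i, gaussianPDFReal 0 1 (x i))) volume :=
    (ENNReal.measurable_ofReal.comp (Finset.measurable_prod _
      fun i _ => (measurable_gaussianPDFReal 0 1).comp (measurable_pi_apply i))).aemeasurable
  rw [← h1, lintegral_map hf hm, ← map_pi_eq_stdGaussian, lintegral_map (f := fun a => f ((stdOrthonormalBasis ℝ E).repr.symm a)) (hf.comp hm) (by fun_prop),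
    bl_pi_gauss_density, lintegral_withDensity_eq_lintegral_mul₀ hpm (by fun_prop),
    ← h2.lintegral_comp (by fun_prop),
    ← (EuclideanSpace.volume_preserving_symm_measurableEquiv_toLp (Fin (Module.finrank ℝ E))).symm.lintegral_comp (by fun_prop)]
  refine lintegral_congr fun x => ?_
  have := bl_pi_pdf _ (WithLp.toLp 2 x)
  simp only [Pi.mul_apply]
  rw [mul_comm]
  rw [LinearIsometryEquiv.norm_map]
  congr 1
  congr 1

theorem bl_polar [Nontrivial E] (φ : E → ENNReal) (hφ : Measurable φ)
    (hom : ∀ (c : ℝ) (x : E), 0 < c → φ (c • x) = φ x) (g : ℝ → ENNReal) (hg : Measurable g) :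
    ∫⁻ x, φ x * g ‖x‖ = (∫⁻ u, φ u ∂((volume : Measure E).toSphere)) *
      (∫⁻ r, g r ∂(Measure.volumeIoiPow (Module.finrank ℝ E - 1))) := by
  have hp := (volume : Measure E).measurePreserving_homeomorphUnitSphereProd
  rw [← lintegral_prod_mul (by fun_prop) (by fun_prop), ← hp.lintegral_comp (by fun_prop)]
  have h0 : ∫⁻ x, φ x * g ‖x‖ = ∫⁻ x in ({0}ᶜ : Set E), φ x * g ‖x‖ := by
    rw [restrict_compl_singleton]
  rw [h0, ← lintegral_subtype_comap (measurableSet_singleton _).compl]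
  refine lintegral_congr fun x => ?_
  have h0 : (x : E) ≠ 0 := x.2
  simp only [homeomorphUnitSphereProd_apply_snd_coe, homeomorphUnitSphereProd_apply_fst_coe]
  rw [hom _ _ (by positivity)]

theorem bl_hom_indep [Nontrivial E] (φ : E → ENNReal) (hφ : Measurable φ)
    (hom : ∀ (c : ℝ) (x : E), 0 < c → φ (c • x) = φ x) (g : ℝ → ENNReal) (hg : Measurable g) :
    ∫⁻ x, φ x * g ‖x‖ ∂(stdGaussian E) = (∫⁻ x, φ x ∂(stdGaussian E)) * ∫⁻ x, g ‖x‖ ∂(stdGaussian E) := by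
  let ρ : ℝ → ENNReal := fun r => ENNReal.ofReal (((√(2 * Real.pi))⁻¹) ^ (Module.finrank ℝ E)
      * Real.exp (-r ^ 2 / 2))
  have hρ : Measurable ρ := by fun_prop
  have key : ∀ (φ : E → ENNReal) (_ : Measurable φ)
    (_ : ∀ (c : ℝ) (x : E), 0 < c → φ (c • x) = φ x) (g : ℝ → ENNReal) (_ : Measurable g),
     ∫⁻ x, φ x * g ‖x‖ ∂(stdGaussian E) = (∫⁻ u, φ u ∂((volume : Measure E).toSphere)) *
      (∫⁻ r, g r * ρ r ∂(Measure.volumeIoiPow (Module.finrank ℝ E - 1))) := by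
    intro φ hφ hom g hg
    rw [bl_lintegral_stdGaussian _ (by fun_prop)]
    have := bl_polar φ hφ hom (fun r => g r * ρ r) (by fun_prop)
    rw [← this]
    refine lintegral_congr fun x => ?_
    rw [mul_assoc]
  have e1 := key φ hφ hom g hg
  have e2 := key φ hφ hom (fun _ => 1) measurable_const
  have e3 := key (fun _ => 1) measurable_const (fun _ _ _ => rfl) g hg
  have e4 := key (fun _ => 1) measurable_const (fun _ _ _ => rfl) (fun _ => 1) measurable_const
  simp only [mul_one, one_mul] at e2 e3 e4
  rw [e1, e2, e3]
  rw [lintegral_one, measure_univ] at e4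
  generalize (∫⁻ u, φ u ∂((volume : Measure E).toSphere)) = a at *
  generalize (∫⁻ r, g r * ρ r ∂(Measure.volumeIoiPow (Module.finrank ℝ E - 1))) = b at *
  generalize (∫⁻ r, ρ r ∂(Measure.volumeIoiPow (Module.finrank ℝ E - 1))) = b' at *
  generalize (∫⁻ (u : Metric.sphere (0:E) 1), 1 ∂((volume : Measure E).toSphere)) = a' at *
  calc a * b = a * b * (a' * b') := by rw [← e4, mul_one]
    _ = _ := by ring

theorem bl_radial_integral (d : ℕ) (hd : 1 ≤ d) (β c : ℝ) (hc : 0 ≤ c) (hβ : 0 < (d : ℝ) / 2 + β) :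
    ∫⁻ r, ENNReal.ofReal ((r : ℝ) ^ (2 * β)) * ENNReal.ofReal (c * Real.exp (-(r : ℝ) ^ 2 / 2))
      ∂(Measure.volumeIoiPow (d - 1)) = ENNReal.ofReal (c * ((1 / 2) * 2 ^ ((d : ℝ) / 2 + β) * Real.Gamma ((d : ℝ) / 2 + β))) := by
  rw [Measure.volumeIoiPow, lintegral_withDensity_eq_lintegral_mul₀ (by fun_prop) (by fun_prop)]
  have h1 := lintegral_subtype_comap (μ := (volume : Measure ℝ)) (measurableSet_Ioi (a := (0:ℝ)))
    (fun r : ℝ => ENNReal.ofReal (c * (r ^ ((d:ℝ) - 1 + 2 * β) * Real.exp (- (1/2) * r ^ (2:ℝ)))))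
  have h2 : ∀ r : Set.Ioi (0:ℝ), ((fun r : Set.Ioi (0:ℝ) => ENNReal.ofReal (r.1 ^ (d - 1))) * fun r : Set.Ioi (0:ℝ) =>
     ENNReal.ofReal ((r : ℝ) ^ (2 * β)) * ENNReal.ofReal (c * Real.exp (-(r : ℝ) ^ 2 / 2))) r =
     ENNReal.ofReal (c * (r.1 ^ ((d:ℝ) - 1 + 2 * β) * Real.exp (- (1/2) * r.1 ^ (2:ℝ)))) := by
    intro r
    have hr : (0:ℝ) < r.1 := r.2
    simp only [Pi.mul_apply]
    rw [← ENNReal.ofReal_mul (by positivity), ← ENNReal.ofReal_mul (by positivity)]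
    congr 1
    rw [Real.rpow_add hr, ← Real.rpow_natCast, Nat.cast_sub hd, Nat.cast_one, Real.rpow_two]
    rw [show -r.1 ^ 2 / 2 = - (1/2) * r.1 ^ 2 by ring]
    ring
  rw [lintegral_congr h2]
  refine h1.trans ?_
  have hlt : -1 < (d:ℝ) - 1 + 2 * β := by linarith
  rw [← ofReal_integral_eq_lintegral_ofReal]
  · rw [integral_const_mul, integral_rpow_mul_exp_neg_mul_rpow (by norm_num) hlt (by norm_num)]
    congr 1
    rw [show ((d:ℝ) - 1 + 2 * β + 1) / 2 = (d:ℝ)/2 + β by ring]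
    rw [show -((d:ℝ) - 1 + 2 * β + 1) / 2 = -((d:ℝ)/2 + β) by ring]
    rw [Real.rpow_neg (by norm_num), ← Real.inv_rpow (by norm_num)]
    have h3 : ((1:ℝ)/2)⁻¹ = 2 := by norm_num
    rw [h3]
    ring
  · apply Integrable.const_mul
    have := integrableOn_rpow_mul_exp_neg_mul_rpow (p := 2) (b := 1/2) hlt (by norm_num) (by norm_num)
    exact this
  · filter_upwards [ae_restrict_mem measurableSet_Ioi] with x hx
    have : (0:ℝ) < x := hx
    simp only [Pi.zero_apply]
    positivity

/-- The moment constants of chi distributions. -/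
noncomputable def blC (d : ℕ) (β : ℝ) : ℝ := 2 ^ β * Real.Gamma ((d : ℝ) / 2 + β) / Real.Gamma ((d : ℝ) / 2)

theorem bl_norm_moment (d : ℕ) (hd : 1 ≤ d) (hE : Module.finrank ℝ E = d) (β : ℝ)
    (hβ : 0 < (d : ℝ) / 2 + β) :
    ∫⁻ x : E, ENNReal.ofReal (‖x‖ ^ (2 * β)) ∂(stdGaussian E) = ENNReal.ofReal (blC d β) := by
  have : Nontrivial E := Module.nontrivial_of_finrank_pos (R := ℝ) (by omega)
  have key : ∀ β : ℝ, 0 < (d : ℝ) / 2 + β → ∫⁻ x : E, ENNReal.ofReal (‖x‖ ^ (2 * β)) ∂(stdGaussian E) =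
     (volume : Measure E).toSphere Set.univ * ENNReal.ofReal (((√(2 * Real.pi))⁻¹) ^ d * ((1 / 2) * 2 ^ ((d : ℝ) / 2 + β) * Real.Gamma ((d : ℝ) / 2 + β))) := by
    intro β hβ
    rw [← bl_radial_integral d hd β _ (by positivity) hβ, bl_lintegral_stdGaussian _ (by fun_prop)]
    have := bl_polar (E := E) (fun _ => 1) measurable_const (fun _ _ _ => rfl)
      (fun r => ENNReal.ofReal ((r : ℝ) ^ (2 * β)) * ENNReal.ofReal (((√(2 * Real.pi))⁻¹) ^ d * Real.exp (-(r : ℝ) ^ 2 / 2)))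
      (by fun_prop)
    rw [lintegral_one, hE] at this
    rw [← this, hE]
    simp
  have hd0 : (0:ℝ) < (d:ℝ)/2 := by positivity
  have h0 := key 0 (by linarith)
  rw [key β hβ]
  simp only [mul_zero, Real.rpow_zero, ENNReal.ofReal_one, lintegral_one, measure_univ, add_zero] at h0
  have hG : 0 < Real.Gamma ((d:ℝ)/2) := Real.Gamma_pos_of_pos hd0
  have hG' : 0 < Real.Gamma ((d:ℝ)/2 + β) := Real.Gamma_pos_of_pos hβ
  have : ((√(2 * Real.pi))⁻¹) ^ d * ((1 / 2) * 2 ^ ((d : ℝ) / 2 + β) * Real.Gamma ((d : ℝ) / 2 + β)) =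
     ((√(2 * Real.pi))⁻¹) ^ d * ((1 / 2) * 2 ^ ((d : ℝ) / 2) * Real.Gamma ((d : ℝ) / 2)) * blC d β := by
    rw [Real.rpow_add (by norm_num), blC]
    field_simp
  rw [this, ENNReal.ofReal_mul (by positivity), ← mul_assoc, ← h0, one_mul]
end

section
variable {V : Type*} [NormedAddCommGroup V] [InnerProductSpace ℝ V] [FiniteDimensional ℝ V]
  [MeasurableSpace V] [BorelSpace V]

theorem bl_null_zero [Nontrivial V] : stdGaussian V {0} = 0 := by
  have h := bl_lintegral_stdGaussian (E := V) (fun x => Set.indicator {0} (fun _ => 1) x)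
    (measurable_const.indicator (measurableSet_singleton 0))
  rw [lintegral_indicator (measurableSet_singleton 0)] at h
  simp only [lintegral_const, Measure.restrict_apply MeasurableSet.univ, Set.univ_inter, one_mul] at h
  rw [h, lintegral_eq_zero_iff' ]
  · have : ∀ᵐ x : V, x ≠ 0 := by
      rw [ae_iff]; simp
    filter_upwards [this] with x hx
    simp [Set.indicator, hx]
  · apply Measurable.aemeasurable
    refine (measurable_const.indicator (measurableSet_singleton 0)).mul ?_
    fun_prop

theorem bl_map_proj (W : Submodule ℝ V) :
    (stdGaussian V).map W.orthogonalProjectionOnto = stdGaussian W := by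
  have : IsProbabilityMeasure ((stdGaussian V).map W.orthogonalProjectionOnto) :=
    Measure.isProbabilityMeasure_map (by fun_prop)
  apply Measure.ext_of_charFun
  ext t
  rw [charFun_stdGaussian]
  rw [charFun, integral_map (by fun_prop) (by fun_prop)]
  have : ∀ x : V, inner ℝ (W.orthogonalProjectionOnto x) t = inner ℝ x (t : V) := by
    intro x; simp
  simp_rw [this]
  have h := charFun_stdGaussian (E := V) (t : V)
  rw [charFun] at h
  rw [h]; simp

theorem bl_indep {ι : Type*} [Fintype ι] (W : ι → Submodule ℝ V)
    (horth : ∀ i j, i ≠ j → W i ⟂ W j) :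
    iIndepFun (fun i => (fun x : V => (W i).orthogonalProjectionOnto x)) (stdGaussian V) := by
  apply HasGaussianLaw.iIndepFun_of_covariance_inner
  · have h1 : HasGaussianLaw (id : V → V) (stdGaussian V) := ⟨by simpa using isGaussian_stdGaussian⟩
    exact h1.map_fun (ContinuousLinearMap.pi fun i => (W i).orthogonalProjectionOnto)
  · intro i j hij x y
    have : ∀ (i) (x : W i) (z : V), inner ℝ x ((W i).orthogonalProjectionOnto z) = inner ℝ (x:V) z := by
      intro i x z; simp
    simp_rw [this]
    rw [← covarianceBilin_apply_eq_cov, covarianceBilin_stdGaussian]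
    · have := (horth i j hij) 
      exact (Submodule.isOrtho_iff_inner_eq.1 this) _ x.2 _ y.2
    · exact IsGaussian.memLp_two_id
end

section
variable {V : Type*} [NormedAddCommGroup V] [InnerProductSpace ℝ V] [FiniteDimensional ℝ V]
  [MeasurableSpace V] [BorelSpace V]

theorem bl_blC_pos (d : ℕ) (hd : 1 ≤ d) (β : ℝ) (hβ : 0 < (d:ℝ)/2 + β) : 0 < blC d β := by
  unfold blC
  have : (0:ℝ) < d / 2 := by positivity
  have := Real.Gamma_pos_of_pos this
  have := Real.Gamma_pos_of_pos hβ
  positivity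

theorem bl_push (W : Submodule ℝ V) (f : W → ENNReal) (hf : Measurable f) :
    ∫⁻ z, f z ∂(stdGaussian W) = ∫⁻ x, f (W.orthogonalProjectionOnto x) ∂(stdGaussian V) := by
  rw [← bl_map_proj W, lintegral_map hf (by fun_prop)]

theorem bl_norm_moment' (W : Submodule ℝ V) (d : ℕ) (hd : 1 ≤ d) (hW : Module.finrank ℝ W = d) (β : ℝ)
    (hβ : 0 < (d:ℝ)/2 + β) :
    ∫⁻ x, ENNReal.ofReal (‖W.starProjection x‖^(2*β)) ∂(stdGaussian V) = ENNReal.ofReal (blC d β) := by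
  rw [← bl_norm_moment d hd hW β hβ, bl_push]
  · rfl
  · fun_prop

theorem bl_prod_moment {ι : Type*} [Fintype ι] (W : ι → Submodule ℝ V)
    (horth : ∀ i j, i ≠ j → W i ⟂ W j) (d : ι → ℕ) (hd : ∀ i, 1 ≤ d i)
    (hW : ∀ i, Module.finrank ℝ (W i) = d i) (a : ι → ℝ) (ha : ∀ i, 0 < (d i:ℝ)/2 + a i) :
    ∫⁻ x, ENNReal.ofReal (∏ i, ‖(W i).starProjection x‖^(2*a i)) ∂(stdGaussian V)
      = ENNReal.ofReal (∏ i, blC (d i) (a i)) := by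
  have h := bl_indep W horth
  have h2 := h.comp (fun i => fun z : W i => ENNReal.ofReal (‖z‖^(2*a i))) (fun i => by fun_prop)
  have h3 := lintegral_prod_eq_prod_lintegral_of_indepFun Finset.univ _ h2 (fun i => by
    apply Measurable.comp <;> fun_prop)
  rw [ENNReal.ofReal_prod_of_nonneg (fun i _ => (bl_blC_pos _ (hd i) _ (ha i)).le)]
  rw [← Finset.prod_congr rfl (fun i _ => bl_norm_moment' (W i) (d i) (hd i) (hW i) (a i) (ha i))]
  convert h3 using 2
  · ext x
    rw [ENNReal.ofReal_prod_of_nonneg (fun i _ => by positivity)]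
    rfl
  · rfl

theorem bl_step {ι : Type*} [Fintype ι] (Wi : ι → Submodule ℝ V) (W : Submodule ℝ V)
    (hle : ∀ i, Wi i ≤ W)
    (horth : ∀ i j, i ≠ j → Wi i ⟂ Wi j) (d : ι → ℕ) (hd : ∀ i, 1 ≤ d i)
    (hWi : ∀ i, Module.finrank ℝ (Wi i) = d i) (D : ℕ) (hD : 1 ≤ D) (hW : Module.finrank ℝ W = D)
    (a : ι → ℝ) (ha : ∀ i, 0 < (d i:ℝ)/2 + a i) (hA : 0 < (D:ℝ)/2 + ∑ i, a i) :
    ∫⁻ x, ENNReal.ofReal ((∏ i, ‖(Wi i).starProjection x‖^(2*a i)) *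
        ‖W.starProjection x‖^(-(2*∑ i, a i))) ∂(stdGaussian V)
      = ENNReal.ofReal ((∏ i, blC (d i) (a i)) / blC D (∑ i, a i)) := by
  have hnt : Nontrivial W := Module.nontrivial_of_finrank_pos (R := ℝ) (by omega)
  set S := ∑ i, a i with hS
  have hPP : ∀ i x, (Wi i).starProjection (W.starProjection x) = (Wi i).starProjection x := by
    intro i x
    have := Submodule.starProjection_comp_starProjection_of_le (hle i)
    exact congrArg (fun f => f x) this
  set φ : W → ENNReal := fun z => ENNReal.ofReal ((∏ i, ‖(Wi i).starProjection (z:V)‖^(2*a i)) *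
        ‖z‖^(-(2*S))) with hφ
  have hφm : Measurable φ := by
    apply ENNReal.measurable_ofReal.comp
    refine Measurable.mul (Finset.measurable_prod _ fun i _ => ?_) (by fun_prop)
    have : Measurable fun z : W => (Wi i).starProjection (z:V) := by
      apply Continuous.measurable; fun_prop
    exact this.norm.pow_const _
  have hom : ∀ (c : ℝ) (x : W), 0 < c → φ (c • x) = φ x := by
    intro c x hc
    simp only [hφ]
    congr 1
    have h1 : ∀ i, ‖(Wi i).starProjection ((c • x : W):V)‖^(2*a i)
        = c^(2*a i) * ‖(Wi i).starProjection (x:V)‖^(2*a i) := by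
      intro i
      rw [Submodule.coe_smul, map_smul, norm_smul, Real.norm_of_nonneg hc.le, Real.mul_rpow hc.le (norm_nonneg _)]
    simp_rw [h1]
    rw [Finset.prod_mul_distrib, ← Real.rpow_sum_of_pos hc, ← Finset.mul_sum, ← hS,
      norm_smul, Real.norm_of_nonneg hc.le, Real.mul_rpow hc.le (norm_nonneg _), Real.rpow_neg hc.le]
    have : c ^ (2*S) ≠ 0 := (Real.rpow_pos_of_pos hc _).ne'
    field_simp
  have hstep := bl_hom_indep φ hφm hom (fun r => ENNReal.ofReal (r^(2*S))) (by fun_prop)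
  rw [bl_norm_moment D hD hW S hA] at hstep
  have hL : ∫⁻ z : W, φ z * ENNReal.ofReal (‖z‖^(2*S)) ∂(stdGaussian W)
      = ENNReal.ofReal (∏ i, blC (d i) (a i)) := by
    rw [← bl_prod_moment Wi horth d hd hWi a ha]
    have h1 : ∫⁻ z : W, φ z * ENNReal.ofReal (‖z‖^(2*S)) ∂(stdGaussian W)
      = ∫⁻ z : W, ENNReal.ofReal (∏ i, ‖(Wi i).starProjection (z:V)‖^(2*a i)) ∂(stdGaussian W) := by
      apply lintegral_congr_ae
      have : ∀ᵐ z ∂(stdGaussian W), z ≠ 0 := by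
        rw [ae_iff]; simpa using bl_null_zero (V := W)
      filter_upwards [this] with z hz
      simp only [hφ]
      rw [← ENNReal.ofReal_mul (by positivity), mul_assoc, ← Real.rpow_add (by positivity)]
      simp
    rw [h1, bl_push]
    · refine lintegral_congr fun x => ?_
      congr 2; ext i
      exact congrArg (fun v => ‖v‖ ^ (2 * a i)) (hPP i x)
    · apply ENNReal.measurable_ofReal.comp
      refine (Finset.measurable_prod _ fun i _ => ?_)
      have : Measurable fun z : W => (Wi i).starProjection (z:V) := by
        apply Continuous.measurable; fun_prop
      exact this.norm.pow_const _
  rw [hL, bl_push W φ hφm] at hstep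
  have hpos := bl_blC_pos D hD S hA
  rw [ENNReal.ofReal_div_of_pos hpos, hstep, ENNReal.mul_div_cancel_right]
  · refine lintegral_congr fun x => ?_
    simp only [hφ]
    congr 2
    refine Finset.prod_congr rfl fun i _ => ?_
    exact congrArg (fun v => ‖v‖ ^ (2 * a i)) (hPP i x).symm
  · simpa using hpos
  · simp
end

section
variable {V : Type*} [NormedAddCommGroup V] [InnerProductSpace ℝ V] [FiniteDimensional ℝ V]

theorem bl_gram_cons {n : ℕ} (v : V) (vs : Fin n → V) :
    (gram ℝ (Fin.cons v vs : Fin (n+1) → V)).det =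
      (gram ℝ vs).det * ‖(Submodule.span ℝ (Set.range vs))ᗮ.starProjection v‖^2 := by
  set S := Submodule.span ℝ (Set.range vs) with hS
  set u := S.starProjection v with hu
  set w := Sᗮ.starProjection v with hw
  have huw : v = u + w := by
    rw [hu, hw]; exact (Submodule.starProjection_add_starProjection_orthogonal (K := S) v).symm
  have huS : u ∈ S := Submodule.starProjection_apply_mem _ _
  have hwS : w ∈ Sᗮ := Submodule.starProjection_apply_mem _ _
  obtain ⟨c, hc⟩ := (Submodule.mem_span_range_iff_exists_fun ℝ).1 huS
  set X : Fin (n+1) → V := Fin.cons v vs with hX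
  set M := gram ℝ X with hM
  have hrow : M = M.updateRow 0 ((fun j => inner ℝ u (X j)) + (fun j => inner ℝ w (X j))) := by
    conv_lhs => rw [← updateRow_eq_self M 0]
    congr 1
    ext j
    simp only [hM, gram_apply, Pi.add_apply, ← inner_add_left, ← huw]
    simp [hX]
  rw [hrow, det_updateRow_add]
  have h1 : (M.updateRow 0 (fun j => inner ℝ u (X j))).det = 0 := by
    have := det_updateRow_sum_aux M (j := 0) (Finset.univ.image Fin.succ) (by simp) (Fin.cons 0 c) 0
    rw [zero_smul, zero_smul] at this
    rw [← this]
    congr 2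
    ext j
    rw [← hc]
    rw [Finset.sum_image (fun a _ b _ h => Fin.succ_injective _ h)]
    simp [sum_inner, inner_smul_left, hM, hX]
  rw [h1, zero_add, det_succ_row_zero, Finset.sum_eq_single 0]
  · have h2 : inner ℝ w (X 0) = ‖w‖^2 := by
      simp only [hX, Fin.cons_zero]
      conv_lhs => rw [huw]
      rw [inner_add_right, real_inner_self_eq_norm_sq, real_inner_comm, hwS u huS, zero_add]
    simp only [updateRow_self, h2]
    have : ((M.updateRow 0 fun j => inner ℝ w (X j)).submatrix Fin.succ (Fin.succAbove 0)) = gram ℝ vs := by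
      ext i j
      simp [hM, hX]
    rw [this]; simp [mul_comm]
  · intro b _ hb
    obtain ⟨b, rfl⟩ := Fin.exists_succ_eq.2 hb
    have : inner ℝ w (X b.succ) = 0 := by
      rw [real_inner_comm]; exact hwS _ (by simp only [hX, Fin.cons_succ]; exact Submodule.subset_span ⟨b, rfl⟩)
    simp [this]
  · simp

noncomputable def blW (G : Submodule ℝ V) {n : ℕ} (vs : Fin n → V) : Submodule ℝ V :=
  (Submodule.span ℝ (Set.range fun j => G.starProjection (vs j)))ᗮ ⊓ G

noncomputable def blD (G : Submodule ℝ V) {n : ℕ} (vs : Fin n → V) : ℝ :=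
  (gram ℝ fun j => G.starProjection (vs j)).det

theorem blD_cons (G : Submodule ℝ V) {n : ℕ} (v : V) (vs : Fin n → V) :
    blD G (Fin.cons v vs : Fin (n+1) → V) = blD G vs * ‖(blW G vs).starProjection v‖^2 := by
  unfold blD
  have h : (fun j => G.starProjection ((Fin.cons v vs : Fin (n+1) → V) j))
      = Fin.cons (G.starProjection v) (fun j => G.starProjection (vs j)) := by
    ext j; refine Fin.cases ?_ (fun j => ?_) j <;> simp
  rw [h, bl_gram_cons]
  congr 3
  set S := Submodule.span ℝ (Set.range fun j => G.starProjection (vs j)) with hS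
  have hSG : S ≤ G := by
    rw [hS, Submodule.span_le]; rintro _ ⟨j, rfl⟩; exact Submodule.starProjection_apply_mem _ _
  have hdec := Submodule.starProjection_add_starProjection_orthogonal (K := S) (G.starProjection v)
  symm
  apply Submodule.eq_starProjection_of_mem_orthogonal
  · refine Submodule.mem_inf.2 ⟨Submodule.starProjection_apply_mem _ _, ?_⟩
    rw [← eq_sub_iff_add_eq'] at hdec
    rw [hdec]
    exact G.sub_mem (Submodule.starProjection_apply_mem _ _) (hSG (Submodule.starProjection_apply_mem _ _))
  · have : v - Sᗮ.starProjection (G.starProjection v) = (v - G.starProjection v) + S.starProjection (G.starProjection v) := by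
      nth_rewrite 2 [← hdec]; abel
    rw [this]
    apply Submodule.add_mem
    · exact Submodule.orthogonal_le inf_le_right (Submodule.sub_starProjection_mem_orthogonal v)
    · apply Submodule.orthogonal_le (inf_le_left : Sᗮ ⊓ G ≤ Sᗮ)
      exact Submodule.le_orthogonal_orthogonal _ (Submodule.starProjection_apply_mem _ _)

theorem blD_nonneg (G : Submodule ℝ V) {n : ℕ} (vs : Fin n → V) : 0 ≤ blD G vs :=
  (posSemidef_gram ℝ _).det_nonneg

theorem blD_zero (G : Submodule ℝ V) (vs : Fin 0 → V) : blD G vs = 1 := by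
  simp [blD]

theorem blW_finrank (G : Submodule ℝ V) {n : ℕ} (vs : Fin n → V) (h : blD G vs ≠ 0) :
    n + Module.finrank ℝ (blW G vs) = Module.finrank ℝ G := by
  have hl := det_gram_ne_zero_iff_linearIndependent.1 h
  have h1 := finrank_span_eq_card hl
  have hSG : Submodule.span ℝ (Set.range fun j => G.starProjection (vs j)) ≤ G := by
    rw [Submodule.span_le]; rintro _ ⟨j, rfl⟩; exact Submodule.starProjection_apply_mem _ _
  have h2 := Submodule.finrank_add_inf_finrank_orthogonal hSG
  rw [h1, Fintype.card_fin] at h2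
  exact h2

theorem blW_le (G G' : Submodule ℝ V) (hG : G' ≤ G) {n : ℕ} (vs : Fin n → V) : blW G' vs ≤ blW G vs := by
  intro x hx
  obtain ⟨hx1, hx2⟩ := Submodule.mem_inf.1 hx
  refine Submodule.mem_inf.2 ⟨?_, hG hx2⟩
  rw [Submodule.mem_orthogonal] at hx1 ⊢
  intro u hu
  induction hu using Submodule.span_induction with
  | mem u hu =>
    obtain ⟨j, rfl⟩ := hu
    have := hx1 _ (Submodule.subset_span ⟨j, rfl⟩)
    simp only at this ⊢
    rw [Submodule.inner_starProjection_left_eq_right, Submodule.starProjection_eq_self_iff.2 hx2] at this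
    rw [Submodule.inner_starProjection_left_eq_right, Submodule.starProjection_eq_self_iff.2 (hG hx2), this]
  | zero => simp
  | add a b _ _ ha hb => rw [inner_add_left, ha, hb, zero_add]
  | smul c a _ ha => rw [inner_smul_left, ha, mul_zero]

theorem blD_continuous (G : Submodule ℝ V) (n : ℕ) : Continuous fun vs : Fin n → V => blD G vs := by
  unfold blD
  apply Continuous.matrix_det
  unfold gram
  apply continuous_matrix
  intro i j
  simp only [of_apply]
  fun_prop

end

section
variable {V : Type*} [NormedAddCommGroup V] [InnerProductSpace ℝ V] [FiniteDimensional ℝ V]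
  [MeasurableSpace V] [BorelSpace V]

theorem bl_pi_succ (c : ℕ) (f : (Fin (c+1) → V) → ENNReal) (hf : Measurable f) :
    ∫⁻ xs, f xs ∂(Measure.pi fun _ : Fin (c+1) => stdGaussian V) =
      ∫⁻ vs, ∫⁻ v, f (Fin.cons v vs : Fin (c+1) → V) ∂(stdGaussian V) ∂(Measure.pi fun _ : Fin c => stdGaussian V) := by
  have h := (measurePreserving_piFinSuccAbove (fun _ : Fin (c+1) => stdGaussian V) 0).symm
  rw [← h.lintegral_comp hf, lintegral_prod_symm']
  · simp [MeasurableEquiv.piFinSuccAbove, Fin.insertNthEquiv, Fin.insertNth_zero']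
  · exact hf.comp h.measurable

theorem bl_proj_ne (W : Submodule ℝ V) (h : 1 ≤ Module.finrank ℝ W) :
    ∀ᵐ v ∂(stdGaussian V), W.starProjection v ≠ 0 := by
  have hnt : Nontrivial W := Module.nontrivial_of_finrank_pos (R := ℝ) (by omega)
  have : ∀ᵐ z ∂(stdGaussian W), z ≠ 0 := by
    rw [ae_iff]; simpa using bl_null_zero (V := W)
  rw [← bl_map_proj W] at this
  have := ae_of_ae_map (by fun_prop) this
  filter_upwards [this] with v hv h0
  apply hv
  exact Subtype.ext h0

theorem blD_ae_ne (G : Submodule ℝ V) (p : ℕ) (hp : p ≤ Module.finrank ℝ G) :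
    ∀ᵐ xs ∂(Measure.pi fun _ : Fin p => stdGaussian V), blD G xs ≠ 0 := by
  induction p with
  | zero => exact Eventually.of_forall fun xs => by simp [blD_zero]
  | succ c ih =>
    have hm : MeasurableSet {xs : Fin (c+1) → V | blD G xs = 0} :=
      (isClosed_singleton.preimage (blD_continuous G (c+1))).measurableSet
    rw [ae_iff]
    simp only [not_not]
    rw [← lintegral_indicator_one hm, bl_pi_succ _ _ (measurable_one.indicator hm)]
    rw [lintegral_eq_zero_iff']
    · filter_upwards [ih (by omega)] with vs hvs
      simp only [Pi.zero_apply]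
      rw [lintegral_eq_zero_iff']
      · have := blW_finrank G vs hvs
        filter_upwards [bl_proj_ne (blW G vs) (by omega)] with v hv
        simp [Set.indicator, blD_cons, hvs, hv]
      · apply Measurable.aemeasurable
        apply (measurable_one.indicator hm).comp
        apply Continuous.measurable; fun_prop
    · apply Measurable.aemeasurable
      apply Measurable.lintegral_prod_right' (f := fun q : (Fin c → V) × V => Set.indicator {xs : Fin (c+1) → V | blD G xs = 0} 1 (Fin.cons q.2 q.1 : Fin (c+1) → V))
      apply (measurable_one.indicator hm).comp
      apply Continuous.measurable; fun_prop

theorem bl_main_moment {ι : Type*} [Fintype ι] (G : ι → Submodule ℝ V) (GG : Submodule ℝ V)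
    (hle : ∀ i, G i ≤ GG) (horth : ∀ i j, i ≠ j → G i ⟂ G j)
    (m : ι → ℕ) (hm : ∀ i, Module.finrank ℝ (G i) = m i) (N : ℕ) (hN : Module.finrank ℝ GG = N)
    (a : ι → ℝ) (p : ℕ) (hpm : ∀ i, p ≤ m i) (hpN : p ≤ N)
    (ha : ∀ c < p, ∀ i, 0 < ((m i - c : ℕ):ℝ)/2 + a i)
    (hA : ∀ c < p, 0 < ((N - c : ℕ):ℝ)/2 + ∑ i, a i) :
    ∫⁻ xs, ENNReal.ofReal ((∏ i, blD (G i) xs ^ (a i)) * blD GG xs ^ (-∑ i, a i))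
      ∂(Measure.pi fun _ : Fin p => stdGaussian V) =
    ∏ c ∈ Finset.range p, ENNReal.ofReal ((∏ i, blC (m i - c) (a i)) / blC (N - c) (∑ i, a i)) := by
  induction p with
  | zero => simp [blD_zero]
  | succ c ih =>
    rw [Finset.prod_range_succ, ← ih (fun i => by have := hpm i; omega) (by omega)
      (fun c hc => ha c (by omega)) (fun c hc => hA c (by omega))]
    have hmeas : ∀ c : ℕ, Measurable fun xs : Fin c → V =>
        ENNReal.ofReal ((∏ i, blD (G i) xs ^ (a i)) * blD GG xs ^ (-∑ i, a i)) := by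
      intro c
      apply ENNReal.measurable_ofReal.comp
      refine Measurable.mul (Finset.measurable_prod _ fun i _ => ?_) ?_
      · exact (blD_continuous _ _).measurable.pow_const _
      · exact (blD_continuous _ _).measurable.pow_const _
    rw [bl_pi_succ _ _ (hmeas _), ← lintegral_mul_const _ (hmeas _)]
    apply lintegral_congr_ae
    have h1 : ∀ᵐ xs ∂(Measure.pi fun _ : Fin c => stdGaussian V), ∀ i, blD (G i) xs ≠ 0 :=
      ae_all_iff.2 fun i => blD_ae_ne (G i) c (by rw [hm]; have := hpm i; omega)
    filter_upwards [h1, blD_ae_ne GG c (by omega)] with vs hvs hvs2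
    have hfi : ∀ i, Module.finrank ℝ (blW (G i) vs) = m i - c := fun i => by
      have := blW_finrank (G i) vs (hvs i); rw [hm] at this; omega
    have hf : Module.finrank ℝ (blW GG vs) = N - c := by
      have := blW_finrank GG vs hvs2; omega
    have hst := bl_step (fun i => blW (G i) vs) (blW GG vs) (fun i => blW_le _ _ (hle i) vs)
      (fun i j hij => (horth i j hij).mono inf_le_right inf_le_right) (fun i => m i - c)
      (fun i => by have := hpm i; omega) hfi (N - c) (by omega) hf a (ha c (by omega)) (hA c (by omega))
    rw [← hst, ← lintegral_const_mul]
    · refine lintegral_congr fun v => ?_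
      rw [← ENNReal.ofReal_mul]
      · congr 1
        have h2 : ∀ (G : Submodule ℝ V) (t : ℝ), blD G (Fin.cons v vs : Fin (c+1) → V) ^ t
            = blD G vs ^ t * ‖(blW G vs).starProjection v‖ ^ (2 * t) := by
          intro G t
          rw [blD_cons, Real.mul_rpow (blD_nonneg _ _) (by positivity), ← Real.rpow_natCast,
            ← Real.rpow_mul (norm_nonneg _)]
          norm_cast
        simp_rw [h2]
        rw [Finset.prod_mul_distrib, mul_neg]
        ring
      · exact mul_nonneg (Finset.prod_nonneg fun i _ => Real.rpow_nonneg (blD_nonneg _ _) _) (Real.rpow_nonneg (blD_nonneg _ _) _)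
    · apply ENNReal.measurable_ofReal.comp
      refine Measurable.mul (Finset.measurable_prod _ fun i _ => ?_) ?_
      · apply Measurable.pow_const; apply Continuous.measurable; fun_prop
      · apply Measurable.pow_const; apply Continuous.measurable; fun_prop
end

theorem bl_curry (ι : Type) [Fintype ι] (p : ℕ) :
    MeasurePreserving (fun (ω : ι × Fin p → ℝ) (c : Fin p) => (WithLp.toLp 2 (fun a => ω (a, c)) : EuclideanSpace ℝ ι))
      (Measure.pi fun _ => gaussianReal 0 1) (Measure.pi fun _ : Fin p => stdGaussian (EuclideanSpace ℝ ι)) := by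
  have h1 := measurePreserving_piCongrLeft (fun _ : Fin p × ι => gaussianReal 0 1) (Equiv.prodComm ι (Fin p))
  have h2 : MeasurePreserving (MeasurableEquiv.curry (Fin p) ι ℝ) (Measure.pi fun _ => gaussianReal 0 1)
      (Measure.pi fun _ => Measure.pi fun _ => gaussianReal 0 1) := by
    refine ⟨MeasurableEquiv.measurable _, ?_⟩
    have := Measure.infinitePi_map_curry (ι := Fin p) (κ := ι) (fun _ _ => gaussianReal 0 1)
    simpa only [Measure.infinitePi_eq_pi] using this
  have h3 : MeasurePreserving (fun (x : Fin p → ι → ℝ) c => (WithLp.toLp 2 (x c) : EuclideanSpace ℝ ι))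
      (Measure.pi fun _ => Measure.pi fun _ => gaussianReal 0 1)
      (Measure.pi fun _ : Fin p => stdGaussian (EuclideanSpace ℝ ι)) := by
    apply measurePreserving_pi
    intro i
    exact ⟨by fun_prop, map_pi_eq_stdGaussian⟩
  have := h3.comp (h2.comp h1)
  convert this using 1
  ext ω c a
  simp [MeasurableEquiv.piCongrLeft, Equiv.piCongrLeft, MeasurableEquiv.coe_curry, Equiv.piCongrLeft']

section
variable {k : ℕ} (nn : Fin k → ℕ)

noncomputable def blmean (x : EuclideanSpace ℝ ((i : Fin k) × Fin (nn i))) (i : Fin k) : ℝ :=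
  (∑ j, x ⟨i, j⟩) / (nn i)

/-- centering operator restricted to groups in `S` -/
noncomputable def blT (S : Finset (Fin k)) :
    EuclideanSpace ℝ ((i : Fin k) × Fin (nn i)) →ₗ[ℝ] EuclideanSpace ℝ ((i : Fin k) × Fin (nn i)) where
  toFun x := WithLp.toLp 2 fun a => if a.1 ∈ S then x a - blmean nn x a.1 else 0
  map_add' x y := by
    ext a; simp only [blmean, PiLp.add_apply, Finset.sum_add_distrib]; split_ifs <;> ring
  map_smul' c x := by
    ext a; simp only [blmean, PiLp.smul_apply, smul_eq_mul, ← Finset.mul_sum, RingHom.id_apply]; split_ifs <;> ring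

theorem blT_apply (S : Finset (Fin k)) (x) (a) : blT nn S x a = if a.1 ∈ S then x a - blmean nn x a.1 else 0 := rfl

theorem blT_sum (hn : ∀ i, 0 < nn i) (S : Finset (Fin k)) (x) (i) : ∑ j, blT nn S x ⟨i, j⟩ = 0 := by
  simp only [blT_apply]
  split_ifs
  · rw [Finset.sum_sub_distrib]
    have : (nn i : ℝ) ≠ 0 := by exact_mod_cast (hn i).ne'
    rw [Finset.sum_const]
    simp only [Finset.card_univ, Fintype.card_fin, nsmul_eq_mul, blmean]
    field_simp; simp
  · simp

theorem blT_inter (hn : ∀ i, 0 < nn i) (S S' : Finset (Fin k)) (x) : blT nn S (blT nn S' x) = blT nn (S ∩ S') x := by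
  ext a
  rw [blT_apply, blmean, blT_sum nn hn]
  simp only [blT_apply, Finset.mem_inter]
  split_ifs <;> simp_all

theorem blT_symm (S : Finset (Fin k)) (x y) : inner ℝ (blT nn S x) y = inner ℝ x (blT nn S y) := by
  simp only [PiLp.inner_apply, Fintype.sum_sigma, blT_apply]
  refine Finset.sum_congr rfl fun i _ => ?_
  split_ifs
  · simp only [RCLike.inner_apply, conj_trivial, mul_sub, sub_mul, Finset.sum_sub_distrib]
    rw [← Finset.mul_sum, ← Finset.sum_mul]
    simp only [blmean]
    ring
  · simp

theorem blT_proj (hn : ∀ i, 0 < nn i) (S : Finset (Fin k)) (x) : (LinearMap.range (blT nn S)).starProjection x = blT nn S x := by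
  refine Submodule.eq_starProjection_of_mem_of_inner_eq_zero (LinearMap.mem_range_self _ x) ?_
  rintro _ ⟨y, rfl⟩
  rw [inner_sub_left, ← blT_symm, ← blT_symm, blT_inter nn hn, Finset.inter_self, sub_self]

theorem blT_finrank (hn : ∀ i, 0 < nn i) (S : Finset (Fin k)) :
    Module.finrank ℝ (LinearMap.range (blT nn S)) = ∑ i ∈ S, (nn i - 1) := by
  have hp : LinearMap.IsProj (LinearMap.range (blT nn S)) (blT nn S) := by
    refine ⟨fun x => ⟨x, rfl⟩, ?_⟩
    rintro _ ⟨y, rfl⟩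
    rw [blT_inter nn hn, Finset.inter_self]
  have h1 := hp.trace
  rw [LinearMap.trace_eq_sum_inner _ (EuclideanSpace.basisFun _ ℝ)] at h1
  have : ((∑ i ∈ S, (nn i - 1) : ℕ) : ℝ) = Module.finrank ℝ (LinearMap.range (blT nn S)) := by
    rw [← h1, Fintype.sum_sigma]
    push_cast
    rw [← Finset.sum_ite_mem_eq S]
    refine Finset.sum_congr rfl fun i _ => ?_
    simp only [EuclideanSpace.basisFun_inner, blT_apply]
    split_ifs
    · have : (nn i : ℝ) ≠ 0 := by exact_mod_cast (hn i).ne'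
      simp [blmean, Nat.cast_sub (hn i), EuclideanSpace.basisFun_apply]
      field_simp
    · simp
  exact_mod_cast this.symm

theorem blT_orth (hn : ∀ i, 0 < nn i) (i j : Fin k) (hij : i ≠ j) :
    LinearMap.range (blT nn {i}) ⟂ LinearMap.range (blT nn {j}) := by
  rw [Submodule.isOrtho_iff_inner_eq]
  rintro _ ⟨x, rfl⟩ _ ⟨y, rfl⟩
  rw [blT_symm, blT_inter nn hn]
  have : ({i} : Finset (Fin k)) ∩ {j} = ∅ := by simp [hij]
  rw [this]
  have : blT nn ∅ y = 0 := by ext a; simp [blT_apply]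
  simp [this]

theorem blT_le (hn : ∀ i, 0 < nn i) (i : Fin k) :
    LinearMap.range (blT nn {i}) ≤ LinearMap.range (blT nn Finset.univ) := by
  rintro _ ⟨x, rfl⟩
  exact ⟨blT nn {i} x, by rw [blT_inter nn hn, Finset.univ_inter]⟩

theorem blT_gram (hn : ∀ i, 0 < nn i) (p : ℕ) (S : Finset (Fin k)) (ω : ((i : Fin k) × Fin (nn i)) × Fin p → ℝ) :
    blD (LinearMap.range (blT nn S)) (fun c : Fin p => (WithLp.toLp 2 (fun a => ω (a, c)) : EuclideanSpace ℝ ((i : Fin k) × Fin (nn i))))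
     = (∑ i ∈ S, ∑ j, Matrix.vecMulVec (fun c => ω (⟨i, j⟩, c) - (∑ j, ω (⟨i, j⟩, c)) / (nn i))
      (fun c => ω (⟨i, j⟩, c) - (∑ j, ω (⟨i, j⟩, c)) / (nn i))).det := by
  unfold blD
  congr 1
  ext c c'
  simp only [gram_apply, blT_proj nn hn, Matrix.sum_apply, vecMulVec_apply, PiLp.inner_apply, Fintype.sum_sigma, blT_apply]
  rw [← Finset.sum_ite_mem_eq S]
  refine Finset.sum_congr rfl fun i _ => ?_
  split_ifs
  · simp [mul_comm, blmean]
  · simp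
end

theorem bl_stat_measurable (k p : ℕ) (nn : Fin k → ℕ) : Measurable (logBartlettStat k p nn) := by
  unfold logBartlettStat
  have hc : ∀ S : Finset (Fin k), Measurable fun ω : ((i : Fin k) × Fin (nn i)) × Fin p → ℝ =>
      (∑ i ∈ S, ∑ j, Matrix.vecMulVec (fun c => ω (⟨i, j⟩, c) - (∑ j, ω (⟨i, j⟩, c)) / (nn i))
      (fun c => ω (⟨i, j⟩, c) - (∑ j, ω (⟨i, j⟩, c)) / (nn i))).det := by
    intro S
    apply Continuous.measurable
    apply Continuous.matrix_det
    apply continuous_matrix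
    intro c c'
    simp only [Matrix.sum_apply, vecMulVec_apply]
    fun_prop
  apply Real.measurable_log.comp
  refine Measurable.mul (Measurable.div (Finset.measurable_prod _ fun i _ => ?_) ?_) measurable_const
  · have := hc {i}
    simp only [Finset.sum_singleton] at this
    exact this.pow_const _
  · exact (hc Finset.univ).pow_const _

theorem bl_stat_moment (k p : ℕ) (hk : 1 ≤ k) (nn : Fin k → ℕ) (hn : ∀ i, p + 1 < nn i) (N : ℕ)
    (hN : N = ∑ i, (nn i - 1)) (h : ℝ)
    (ha : ∀ c < p, ∀ i, 0 < ((nn i - 1 - c : ℕ):ℝ)/2 + h * ((nn i - 1 : ℕ):ℝ) / 2) :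
    ∫⁻ ω, ENNReal.ofReal (Real.exp (h * logBartlettStat k p nn ω)) ∂(Measure.pi fun _ => gaussianReal 0 1)
     = ENNReal.ofReal (Real.exp (h * (N * p / 2 * Real.log N - ∑ i, ((nn i - 1 : ℕ):ℝ) * p / 2 * Real.log ((nn i - 1 : ℕ):ℝ)))
       * ∏ c ∈ Finset.range p, ((∏ i, blC (nn i - 1 - c) (h * ((nn i - 1 : ℕ):ℝ) / 2)) / blC (N - c) (h * N / 2))) := by
  have hn0 : ∀ i, 0 < nn i := fun i => by have := hn i; omega
  have hcast : ∀ i, ((nn i - 1 : ℕ):ℝ) = (nn i : ℝ) - 1 := fun i => by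
    rw [Nat.cast_sub (hn0 i)]; simp
  have hNc : (N:ℝ) = (∑ i, (nn i : ℝ)) - k := by
    rw [hN]; push_cast; simp_rw [hcast]; simp
  let V := EuclideanSpace ℝ ((i : Fin k) × Fin (nn i))
  set a : Fin k → ℝ := fun i => h * ((nn i - 1 : ℕ):ℝ) / 2 with haa
  have hsa : ∑ i, a i = h * N / 2 := by
    rw [hN]; push_cast; rw [Finset.mul_sum, Finset.sum_div]
  have i0 : Fin k := ⟨0, by omega⟩
  have hmN : ∀ i, nn i - 1 ≤ N := fun i => by
    rw [hN]; exact Finset.single_le_sum (f := fun i => nn i - 1) (fun _ _ => Nat.zero_le _) (Finset.mem_univ i)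
  have hpN : p ≤ N := by have := hn i0; have := hmN i0; omega
  have hA : ∀ c < p, 0 < ((N - c : ℕ):ℝ)/2 + ∑ i, a i := by
      intro c hc
      have h1 : 0 < ∑ i, (((nn i - 1 - c : ℕ):ℝ)/2 + a i) :=
        Finset.sum_pos (fun i _ => ha c hc i) ⟨i0, Finset.mem_univ _⟩
      rw [Finset.sum_add_distrib, ← Finset.sum_div] at h1
      have h2 : ∑ i, (nn i - 1 - c) ≤ N - c := by
        have e1 : ∑ i, (nn i - 1 - c) + c ≤ N := by
          rw [hN, ← Finset.add_sum_erase _ _ (Finset.mem_univ i0), ← Finset.add_sum_erase (a := i0) _ _ (Finset.mem_univ i0)]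
          have : ∑ i ∈ Finset.univ.erase i0, (nn i - 1 - c) ≤ ∑ i ∈ Finset.univ.erase i0, (nn i - 1) :=
            Finset.sum_le_sum fun i _ => by omega
          have := hn i0
          omega
        omega
      have h3 : ((∑ i, (nn i - 1 - c) : ℕ) : ℝ) ≤ (N - c : ℕ) := by exact_mod_cast h2
      push_cast at h3
      linarith
  have hmain := bl_main_moment (V := V) (fun i => LinearMap.range (blT nn {i})) (LinearMap.range (blT nn Finset.univ))
    (blT_le nn hn0) (blT_orth nn hn0) (fun i => nn i - 1) (fun i => by rw [blT_finrank nn hn0]; simp) N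
    (by rw [blT_finrank nn hn0, hN]) a p (fun i => by have := hn i; omega) hpN ha hA
  have hmp := bl_curry ((i : Fin k) × Fin (nn i)) p
  have hmeas : Measurable fun xs : Fin p → V => ENNReal.ofReal ((∏ i, blD (LinearMap.range (blT nn {i})) xs ^ (a i)) * blD (LinearMap.range (blT nn Finset.univ)) xs ^ (-∑ i, a i)) := by
    apply ENNReal.measurable_ofReal.comp
    refine Measurable.mul (Finset.measurable_prod _ fun i _ => ?_) ?_
    · exact (blD_continuous _ _).measurable.pow_const _
    · exact (blD_continuous _ _).measurable.pow_const _
  rw [← hmp.lintegral_comp hmeas] at hmain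
  have hpc : ∀ c ∈ Finset.range p, 0 ≤ ((∏ i, blC (nn i - 1 - c) (a i)) / blC (N - c) (∑ i, a i)) := by
    intro c hc
    have hc := Finset.mem_range.1 hc
    refine div_nonneg (Finset.prod_nonneg fun i _ => (bl_blC_pos _ (by have := hn i; omega) _ (ha c hc i)).le) ?_
    exact (bl_blC_pos _ (by have := hn i0; have := hmN i0; omega) _ (hA c hc)).le
  rw [← ENNReal.ofReal_prod_of_nonneg hpc, hsa] at hmain
  rw [ENNReal.ofReal_mul (by positivity), ← hmain, ← lintegral_const_mul]
  · apply lintegral_congr_ae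
    have h1 : ∀ᵐ xs ∂(Measure.pi fun _ : Fin p => stdGaussian V), ∀ i, blD (LinearMap.range (blT nn {i})) xs ≠ 0 :=
      ae_all_iff.2 fun i => blD_ae_ne _ p (by rw [blT_finrank nn hn0]; have := hn i; simp; omega)
    have h2 := blD_ae_ne (V := V) (LinearMap.range (blT nn Finset.univ)) p (by rw [blT_finrank nn hn0]; omega)
    have h1' := hmp.quasiMeasurePreserving.ae h1
    have h2' := hmp.quasiMeasurePreserving.ae h2
    filter_upwards [h1', h2'] with ω hω1 hω2
    rw [← ENNReal.ofReal_mul (by positivity)]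
    congr 1
    have hp1 : ∀ i, (0:ℝ) < _ := fun i => lt_of_le_of_ne (blD_nonneg _ _) (hω1 i).symm
    have hp2 := lt_of_le_of_ne (blD_nonneg _ _) hω2.symm
    unfold logBartlettStat
    dsimp only
    rw [← hNc]
    simp only [← hcast]
    have hA1 : ∀ i, _ := fun i => blT_gram nn hn0 p {i} ω
    have hA2 := blT_gram nn hn0 p Finset.univ ω
    simp only [Finset.sum_singleton] at hA1
    simp only [← hA1, ← hA2]
    have hNpos : (0:ℝ) < N := by
      have := hn i0; have := hmN i0
      have : 0 < N := by omega
      exact_mod_cast this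
    have hmpos : ∀ i, (0:ℝ) < (nn i - 1 : ℕ) := fun i => by
      have := hn i
      have : 0 < nn i - 1 := by omega
      exact_mod_cast this
    have q1 := Finset.prod_pos (s := Finset.univ) fun i _ => Real.rpow_pos_of_pos (hp1 i) (((nn i - 1 : ℕ):ℝ)/2)
    have q2 := Real.rpow_pos_of_pos hp2 ((N:ℝ)/2)
    have q3 := Real.rpow_pos_of_pos hNpos ((N:ℝ) * p / 2)
    have q4 := Finset.prod_pos (s := Finset.univ) fun i _ => Real.rpow_pos_of_pos (hmpos i) (((nn i - 1 : ℕ):ℝ) * p /2)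
    rw [Real.log_mul (div_pos q1 q2).ne' (div_pos q3 q4).ne', Real.log_div q1.ne' q2.ne', Real.log_div q3.ne' q4.ne',
      Real.log_prod (fun i _ => (Real.rpow_pos_of_pos (hp1 i) _).ne'), Real.log_prod (fun i _ => (Real.rpow_pos_of_pos (hmpos i) _).ne'),
      Real.log_rpow hp2, Real.log_rpow hNpos]
    simp_rw [fun i => Real.log_rpow (hp1 i), fun i => Real.log_rpow (hmpos i)]
    simp_rw [fun i => Real.rpow_def_of_pos (hp1 i)]
    rw [Real.rpow_def_of_pos hp2, ← Real.exp_sum, ← Real.exp_add, ← Real.exp_add]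
    congr 1
    simp only [haa]
    have e : ∀ x : Fin k → ℝ, ∑ i, x i * (h * ((nn i - 1 : ℕ):ℝ)/2) = h * ∑ i, ((nn i - 1 : ℕ):ℝ)/2 * x i := by
      intro x; rw [Finset.mul_sum]; exact Finset.sum_congr rfl fun i _ => by ring
    rw [e]
    ring
  · have := hmeas.comp hmp.measurable
    rw [hsa] at this
    exact this

theorem bl_log_bound (u : ℝ) (hu : -(1/2) ≤ u) : |Real.log (1 + u) - u + u^2/2| ≤ 4 * |u|^3 := by
  by_cases h : u ≤ 1/2
  · have habs : |-u| ≤ 1/2 := by rw [abs_neg, abs_le]; constructor <;> linarith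
    have h1 := Real.abs_log_sub_add_sum_range_le (x := -u) (by linarith) 2
    simp [Finset.sum_range_succ] at h1
    rw [abs_neg] at habs
    have h2 : |u|^3 / (1 - |u|) ≤ 4 * |u|^3 := by
      rw [div_le_iff₀ (by linarith)]
      have : 0 ≤ |u|^3 := by positivity
      nlinarith
    refine le_trans (le_of_eq ?_) (h1.trans h2)
    congr 1
    norm_num; ring
  · push Not at h
    have h0 : 0 ≤ Real.log (1+u) := Real.log_nonneg (by linarith)
    have h1 := Real.log_le_sub_one_of_pos (show 0 < 1 + u by linarith)
    rw [abs_of_pos (show 0 < u by linarith), abs_le]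
    constructor <;> nlinarith [mul_pos (show 0 < u by linarith) (show 0 < u - 1/2 by linarith), mul_pos (mul_pos (show 0 < u by linarith) (show 0 < u by linarith)) (show 0 < u - 1/2 by linarith)]

theorem bl_gamma_tendsto (x : ℝ) (hx : 0 < x) :
    Tendsto (fun n : ℕ => Real.log (Real.Gamma (x + n + 1)) - x * Real.log n - Real.log (n.factorial)) atTop (𝓝 0) := by
  have h := Real.BohrMollerup.tendsto_log_gamma hx
  have h2 := (tendsto_const_nhds (x := Real.log (Real.Gamma x))).sub h
  rw [sub_self] at h2
  refine h2.congr fun n => ?_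
  have h3 : ∀ n : ℕ, Real.log (Real.Gamma (x + n)) = Real.log (Real.Gamma x) + ∑ m ∈ Finset.range n, Real.log (x + m) := by
    intro n
    induction n with
    | zero => simp
    | succ n ih =>
      rw [Finset.sum_range_succ, ← add_assoc, ← ih]
      push_cast
      rw [← add_assoc, Real.Gamma_add_one (by positivity), Real.log_mul (by positivity) (Real.Gamma_pos_of_pos (by positivity)).ne']
      ring
  have := h3 (n+1)
  push_cast at this
  rw [← add_assoc] at this
  rw [this]
  simp only [Real.BohrMollerup.logGammaSeq]
  ring

theorem bl_gamma_ratio_tendsto (a t : ℝ) (ha : 0 < a) (hat : 0 < a + t) :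
    Tendsto (fun n : ℕ => Real.log (Real.Gamma (a + n + t)) - Real.log (Real.Gamma (a + n)) - t * Real.log (a + n)
      - (t^2 - t) / (2 * (a + n))) atTop (𝓝 0) := by
  rw [← tendsto_add_atTop_iff_nat 1]
  have h1 := bl_gamma_tendsto (a + t) hat
  have h2 := bl_gamma_tendsto a ha
  have h3 : Tendsto (fun n : ℕ => Real.log (1 + (a + 1) / n)) atTop (𝓝 0) := by
    have : Tendsto (fun n : ℕ => 1 + (a + 1) / (n:ℝ)) atTop (𝓝 (1 + 0)) :=
      tendsto_const_nhds.add (tendsto_const_div_atTop_nhds_zero_nat (a + 1))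
    rw [add_zero] at this
    have := (Real.continuousAt_log one_ne_zero).tendsto.comp this
    rwa [Real.log_one] at this
  have h4 : Tendsto (fun n : ℕ => (t^2 - t) / (2 * (a + (n + 1 : ℕ)))) atTop (𝓝 0) := by
    apply Tendsto.div_atTop tendsto_const_nhds
    apply Tendsto.const_mul_atTop (by norm_num)
    apply tendsto_atTop_add_const_left
    exact tendsto_natCast_atTop_atTop.comp (tendsto_add_atTop_nat 1)
  have := ((h1.sub h2).sub (h3.const_mul t)).sub h4
  simp only [sub_zero, mul_zero] at this
  refine this.congr' ?_
  filter_upwards [eventually_gt_atTop 0] with n hn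
  have hn' : (0:ℝ) < n := by exact_mod_cast hn
  have : Real.log (a + (n+1:ℕ)) = Real.log n + Real.log (1 + (a+1)/n) := by
    rw [← Real.log_mul hn'.ne' (by positivity)]
    congr 1; push_cast; field_simp; ring
  rw [this]
  have e1 : a + t + n + 1 = a + (n+1:ℕ) + t := by push_cast; ring
  have e2 : a + n + 1 = a + (n+1:ℕ) := by push_cast; ring
  rw [e1, e2]
  ring

theorem bl_gamma_step (T a t : ℝ) (ha : 1 ≤ a) (hT : |t| ≤ T) (hat : |t| ≤ a / 2) :
    |(Real.log (1 + t/a) - t * Real.log (1 + 1/a) + (t^2 - t)/(2*a*(a+1)))| ≤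
      2 * (4*T^2+T+5) * |t| * (1/a^2 - 1/(a+1)^2) := by
  have ha0 : 0 < a := by linarith
  have hta : |t/a| ≤ 1/2 := by rw [abs_div, abs_of_pos ha0, div_le_iff₀ ha0]; linarith
  have h1 := bl_log_bound (t/a) (abs_le.1 hta).1
  have h2 := bl_log_bound (1/a) (by have : 0 < 1/a := by positivity
                                    linarith)
  have e : Real.log (1 + t/a) - t * Real.log (1 + 1/a) + (t^2 - t)/(2*a*(a+1))
    = (Real.log (1 + t/a) - t/a + (t/a)^2/2) - t * (Real.log (1 + 1/a) - 1/a + (1/a)^2/2)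
      + t * (-(t - 1)/(2*a^2*(a+1))) := by
    field_simp; ring
  rw [e]
  have ht0 := abs_nonneg t
  have hT0 : 0 ≤ T := ht0.trans hT
  have h3 : |t/a|^3 ≤ T^2 * |t| / a^3 := by
    rw [abs_div, div_pow, abs_of_pos ha0]
    gcongr
    calc |t|^3 = |t|^2*|t| := by ring
      _ ≤ T^2 * |t| := by gcongr
  have h4 : |1/a|^3 = 1/a^3 := by rw [abs_of_pos (by positivity)]; field_simp
  have h5 : |-(t - 1)/(2*a^2*(a+1))| ≤ (T+1)/a^3 := by
    rw [abs_div, abs_neg, abs_of_pos (show 0 < 2*a^2*(a+1) by positivity)]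
    have : |t - 1| ≤ T + 1 := by
      have := abs_sub t 1; rw [abs_one] at this; linarith
    apply div_le_div₀ (by linarith) this (by positivity)
    nlinarith [sq_nonneg a, mul_pos ha0 ha0, mul_pos (mul_pos ha0 ha0) ha0]
  have h6 : 1/a^3 ≤ 2 * (1/a^2 - 1/(a+1)^2) := by
    rw [div_sub_div _ _ (by positivity) (by positivity), ← mul_div_assoc, div_le_div_iff₀ (by positivity) (by positivity)]
    have : 0 ≤ a^2 * (a^2 - 1) := by apply mul_nonneg; positivity; nlinarith
    nlinarith [sq_nonneg a, mul_pos ha0 ha0, mul_pos (mul_pos ha0 ha0) ha0, mul_nonneg (sq_nonneg a) (show 0 ≤ 3*a^2-1 by nlinarith)]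
  calc _ ≤ |Real.log (1 + t/a) - t/a + (t/a)^2/2| + |t * (Real.log (1 + 1/a) - 1/a + (1/a)^2/2)| + |t * (-(t - 1)/(2*a^2*(a+1)))| := by
        refine (abs_add_le _ _).trans ?_
        gcongr
        exact abs_sub _ _
    _ ≤ 4 * (T^2 * |t| / a^3) + |t| * (4 * (1/a^3)) + |t| * ((T+1)/a^3) := by
        rw [abs_mul, abs_mul]
        rw [h4] at h2
        gcongr
        linarith
    _ = (4*T^2+T+5) * |t| * (1/a^3) := by ring
    _ ≤ (4*T^2+T+5) * |t| * (2 * (1/a^2 - 1/(a+1)^2)) := by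
        gcongr
    _ = _ := by ring

theorem bl_gamma_expand (T a t : ℝ) (ha : 1 ≤ a) (hT : |t| ≤ T) (hat : |t| ≤ a / 2) :
    |Real.log (Real.Gamma (a + t)) - Real.log (Real.Gamma a) - t * Real.log a - (t^2 - t)/(2*a)| ≤
      2 * (4*T^2+T+5) * |t| * (1/a^2) := by
  set R : ℕ → ℝ := fun n => Real.log (Real.Gamma (a + n + t)) - Real.log (Real.Gamma (a + n)) - t * Real.log (a + n)
      - (t^2 - t) / (2 * (a + n)) with hR
  have hT0 : 0 ≤ T := (abs_nonneg t).trans hT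
  set K := 2 * (4*T^2+T+5) * |t| with hK
  have hK0 : 0 ≤ K := by positivity
  have hat2 : 0 < a + t := by have := (abs_le.1 hat).1; linarith
  have hstep : ∀ n : ℕ, |R (n+1) - R n| ≤ K * (1/(a+n)^2 - 1/(a+(n+1:ℕ))^2) := by
    intro n
    have hn0 : (0:ℝ) ≤ n := Nat.cast_nonneg n
    have h := bl_gamma_step T (a+n) t (by linarith) hT (by linarith)
    have e3 : a + (n+1:ℕ) = a + n + 1 := by push_cast; ring
    rw [e3]
    refine le_trans (le_of_eq ?_) h
    congr 1
    simp only [hR]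
    rw [e3]
    have e4 : a + n + 1 + t = (a + n + t) + 1 := by ring
    have hp : 0 < a + n + t := by linarith
    have hp2 : 0 < a + n := by linarith
    rw [e4, Real.Gamma_add_one hp.ne', Real.Gamma_add_one hp2.ne', Real.log_mul hp.ne' (Real.Gamma_pos_of_pos hp).ne',
      Real.log_mul hp2.ne' (Real.Gamma_pos_of_pos hp2).ne']
    have e5 : 1 + t/(a+n) = (a+n+t)/(a+n) := by field_simp
    have e6 : 1 + 1/(a+n) = (a+n+1)/(a+n) := by field_simp
    rw [e5, e6, Real.log_div hp.ne' hp2.ne', Real.log_div (by positivity) hp2.ne']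
    field_simp; ring
  have hsum : ∀ n : ℕ, |R 0 - R n| ≤ K * (1/a^2) := by
    intro n
    have : ∀ n : ℕ, |R 0 - R n| ≤ K * (1/a^2 - 1/(a+n)^2) := by
      intro n
      induction n with
      | zero => simp
      | succ n ih =>
        have h1 := hstep n
        have : R 0 - R (n+1) = (R 0 - R n) - (R (n+1) - R n) := by ring
        rw [this]
        refine (abs_sub _ _).trans ?_
        calc _ ≤ K * (1/a^2 - 1/(a+n)^2) + K * (1/(a+n)^2 - 1/(a+(n+1:ℕ))^2) := add_le_add ih h1
          _ = _ := by ring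
    refine (this n).trans ?_
    gcongr
    have : 0 ≤ 1/(a+n)^2 := by positivity
    linarith
  have hlim : Tendsto (fun n => |R 0 - R n|) atTop (𝓝 |R 0 - 0|) :=
    (tendsto_const_nhds.sub (bl_gamma_ratio_tendsto a t (by linarith) hat2)).abs
  have := le_of_tendsto' hlim hsum
  simpa [hR] using this

noncomputable def blH (t x : ℝ) : ℝ := t * ((x - 1/2) * Real.log x - x) + t^2 * Real.log x

theorem bl_log_blC (d : ℕ) (hd : 1 ≤ d) (t : ℝ) (ht : 0 < (d:ℝ)/2 + t) :
    Real.log (blC d t) = t * Real.log 2 + Real.log (Real.Gamma ((d:ℝ)/2 + t)) - Real.log (Real.Gamma ((d:ℝ)/2)) := by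
  unfold blC
  have h1 : (0:ℝ) < d / 2 := by positivity
  have h2 := Real.Gamma_pos_of_pos h1
  have h3 := Real.Gamma_pos_of_pos ht
  have h4 : (0:ℝ) < 2 ^ t := by positivity
  rw [Real.log_div (by positivity) h2.ne', Real.log_mul h4.ne' h3.ne', Real.log_rpow (by norm_num)]

noncomputable def blK (T : ℝ) : ℝ := 8 * (4*T^2+T+5) + 3*T + 6

theorem bl_s_step (T t : ℝ) (d : ℕ) (hd : 2 ≤ d) (hT : |t| ≤ T) (hat : |t| ≤ (d:ℝ) / 4) :
    |Real.log (blC d t) - (blH t d - blH t (d - 1))| ≤ blK T * |t| * (1/(d:ℝ)^2) := by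
  have hd' : (2:ℝ) ≤ d := by exact_mod_cast hd
  have hd0 : (0:ℝ) < d := by linarith
  have hpos : 0 < (d:ℝ)/2 + t := by have := (abs_le.1 hat).1; linarith
  rw [bl_log_blC d (by omega) t hpos]
  have h1 := bl_gamma_expand T ((d:ℝ)/2) t (by linarith) hT (by linarith)
  have hinv : 1/(d:ℝ) ≤ 1/2 := one_div_le_one_div_of_le (by norm_num) hd'
  have h2 := bl_log_bound (-(1/(d:ℝ))) (by linarith)
  have e1 : Real.log ((d:ℝ)/2) = Real.log d - Real.log 2 := Real.log_div hd0.ne' (by norm_num)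
  have e2 : Real.log ((d:ℝ) - 1) = Real.log d + Real.log (1 + -(1/(d:ℝ))) := by
    rw [← Real.log_mul hd0.ne' (by linarith)]; congr 1; field_simp; ring
  set r := Real.log (1 + -(1/(d:ℝ))) - -(1/(d:ℝ)) + (-(1/(d:ℝ)))^2/2 with hr
  set q := Real.log (Real.Gamma ((d:ℝ)/2 + t)) - Real.log (Real.Gamma ((d:ℝ)/2)) - t * Real.log ((d:ℝ)/2) - (t^2 - t)/(2*((d:ℝ)/2)) with hq
  have e3 : Real.log (1 + -(1/(d:ℝ))) = r - 1/(d:ℝ) - 1/(2*(d:ℝ)^2) := by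
    rw [hr]; field_simp; ring
  have e4 : t * Real.log 2 + Real.log (Real.Gamma ((d:ℝ)/2 + t)) - Real.log (Real.Gamma ((d:ℝ)/2))
      = q + t * Real.log d + (t^2 - t)/d := by
    rw [hq, e1]; field_simp; ring
  have e5 : t * Real.log 2 + Real.log (Real.Gamma ((d:ℝ)/2 + t)) - Real.log (Real.Gamma ((d:ℝ)/2)) - (blH t d - blH t (d - 1))
      = q + t * (3/4 * (1/(d:ℝ)^2)) + t * ((d - 3/2) * r) + t * (t * (r - 1/(2*(d:ℝ)^2))) := by
    rw [e4]; unfold blH; rw [e2, e3]; field_simp; ring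
  rw [e5]
  have ht0 := abs_nonneg t
  have hT0 : 0 ≤ T := ht0.trans hT
  have hr1 : |r| ≤ 4 * (1/(d:ℝ)^3) := by
    refine h2.trans (le_of_eq ?_); rw [abs_neg, abs_of_pos (by positivity)]; field_simp
  have hr2 : |r| ≤ 2 * (1/(d:ℝ)^2) := by
    refine hr1.trans ?_
    have : 1/(d:ℝ)^3 = 1/(d:ℝ) * (1/(d:ℝ)^2) := by field_simp
    rw [this]
    have : 0 < 1/(d:ℝ)^2 := by positivity
    nlinarith
  have hr3 : |(d - 3/2) * r| ≤ 4 * (1/(d:ℝ)^2) := by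
    rw [abs_mul, abs_of_pos (by linarith : (0:ℝ) < d - 3/2)]
    calc (d - 3/2) * |r| ≤ d * (4 * (1/(d:ℝ)^3)) := by
          gcongr; linarith
      _ = _ := by field_simp
  have hr4 : |t * (r - 1/(2*(d:ℝ)^2))| ≤ T * (3 * (1/(d:ℝ)^2)) := by
    rw [abs_mul]
    gcongr
    refine (abs_sub _ _).trans ?_
    have : |1/(2*(d:ℝ)^2)| = 1/2 * (1/(d:ℝ)^2) := by rw [abs_of_pos (by positivity)]; field_simp
    rw [this]
    have : 0 < 1/(d:ℝ)^2 := by positivity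
    linarith
  have h1' : |q| ≤ 8 * (4*T^2+T+5) * |t| * (1/(d:ℝ)^2) := by
    refine h1.trans (le_of_eq ?_); field_simp; ring
  calc _ ≤ |q| + |t * (3/4 * (1/(d:ℝ)^2))| + |t * ((d - 3/2) * r)| + |t * (t * (r - 1/(2*(d:ℝ)^2)))| := by
        refine (abs_add_le _ _).trans ?_
        gcongr
        refine (abs_add_le _ _).trans ?_
        gcongr
        exact abs_add_le _ _
    _ ≤ 8 * (4*T^2+T+5) * |t| * (1/(d:ℝ)^2) + |t| * (3/4 * (1/(d:ℝ)^2)) + |t| * (4 * (1/(d:ℝ)^2)) + |t| * (T * (3 * (1/(d:ℝ)^2))) := by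
        rw [abs_mul t, abs_mul t, abs_mul t]
        have : |3/4 * (1/(d:ℝ)^2)| = 3/4 * (1/(d:ℝ)^2) := abs_of_pos (by positivity)
        rw [this]
        gcongr
    _ ≤ _ := by
        unfold blK
        have : 0 ≤ |t| * (1/(d:ℝ)^2) := by positivity
        nlinarith

theorem bl_s_sum (T t : ℝ) (m p : ℕ) (hm : p + 1 ≤ m) (hT : |t| ≤ T) (hat : |t| ≤ ((m:ℝ) - p) / 4) :
    |∑ c ∈ Finset.range p, Real.log (blC (m - c) t) - (blH t m - blH t (m - p))| ≤ blK T * |t| / ((m:ℝ) - p) := by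
  have hT0 : 0 ≤ T := (abs_nonneg t).trans hT
  have hK : 0 ≤ blK T * |t| := by unfold blK; positivity
  have key : |∑ c ∈ Finset.range p, Real.log (blC (m - c) t) - (blH t m - blH t (m - p))| ≤
      blK T * |t| * (1 / ((m:ℝ) - p) - 1/m) := by
    induction p with
    | zero => simp
    | succ c ih =>
      have hm' : ((c:ℝ) + 1) + 1 ≤ m := by exact_mod_cast hm
      push_cast at hat
      have h1 := ih (by omega) (by linarith)
      have h2 := bl_s_step T t (m - c) (by omega) hT (by rw [Nat.cast_sub (by omega)]; linarith)
      rw [Nat.cast_sub (by omega)] at h2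
      rw [Finset.sum_range_succ]
      push_cast
      have e : ∑ x ∈ Finset.range c, Real.log (blC (m - x) t) + Real.log (blC (m - c) t) - (blH t m - blH t (m - (c+1)))
        = (∑ x ∈ Finset.range c, Real.log (blC (m - x) t) - (blH t m - blH t (m - c)))
          + (Real.log (blC (m - c) t) - (blH t (m - c) - blH t (m - c - 1))) := by
        rw [show (m:ℝ) - (c+1) = m - c - 1 by ring]; ring
      rw [e]
      refine (abs_add_le _ _).trans ((add_le_add h1 h2).trans ?_)
      have h3 : 1/((m:ℝ) - c)^2 ≤ 1/((m:ℝ) - (c+1)) - 1/((m:ℝ)-c) := by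
        have a1 : (0:ℝ) < m - c := by linarith
        have a2 : (0:ℝ) < m - (c+1) := by linarith
        rw [div_sub_div _ _ a2.ne' a1.ne', div_le_div_iff₀ (by positivity) (by positivity)]
        nlinarith
      calc _ = blK T * |t| * (1 / ((m:ℝ) - c) - 1/m + 1/((m:ℝ) - c)^2) := by ring
        _ ≤ _ := by
          gcongr; linarith
  refine key.trans ?_
  rw [div_eq_mul_one_div (blK T * |t|)]
  apply mul_le_mul_of_nonneg_left _ hK
  have : (0:ℝ) ≤ 1/m := by positivity
  linarith

noncomputable def blrho (u : ℝ) : ℝ := -Real.log (1 - u) - u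

theorem blrho_ge (u : ℝ) (h0 : 0 ≤ u) (h1 : u < 1) : u^2/2 ≤ blrho u := by
  have h := Real.hasSum_pow_div_log_of_abs_lt_one (x := u) (by rw [abs_of_nonneg h0]; exact h1)
  have := sum_le_hasSum (Finset.range 2) (fun n _ => by positivity) h
  simp [Finset.sum_range_succ] at this
  unfold blrho
  norm_num at this
  linarith

theorem blrho_scale (w u : ℝ) (hw0 : 0 ≤ w) (hw1 : w ≤ 1) (h0 : 0 ≤ u) (h1 : u < 1) :
    blrho (w * u) ≤ w^2 * blrho u := by
  have hwu : w * u < 1 := by nlinarith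
  have hwu0 : 0 ≤ w * u := by positivity
  have ha := Real.hasSum_pow_div_log_of_abs_lt_one (x := u) (by rw [abs_of_nonneg h0]; exact h1)
  have hb := Real.hasSum_pow_div_log_of_abs_lt_one (x := w * u) (by rw [abs_of_nonneg hwu0]; exact hwu)
  have h := (ha.mul_left (w^2)).sub hb
  have := sum_le_hasSum (Finset.range 1) (fun n hn => by
    have hn : 1 ≤ n := by simpa [Nat.one_le_iff_ne_zero] using hn
    have e : w^2 * (u^(n+1)/((n:ℝ)+1)) - (w*u)^(n+1)/((n:ℝ)+1) = (w^2 - w^(n+1)) * (u^(n+1)/((n:ℝ)+1)) := by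
      rw [mul_pow]; ring
    rw [e]
    apply mul_nonneg
    · have := pow_le_pow_of_le_one hw0 hw1 (show 2 ≤ n + 1 by omega)
      linarith
    · positivity) h
  simp at this
  unfold blrho
  linarith

theorem bl_sigma_lower {k : ℕ} (hk : 2 ≤ k) (m : Fin k → ℝ) (p N : ℝ) (hp : 0 < p) (hm : ∀ i, p + 1 ≤ m i)
    (hN : N = ∑ i, m i) (i : Fin k) :
    (p/N)^2 * blrho (p / m i) ≤ Real.log (1 - p / N) - ∑ i, (m i / N)^2 * Real.log (1 - p / m i) := by
  have hmp : ∀ i, 0 < m i := fun i => by have := hm i; linarith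
  have hmN : ∀ i, m i ≤ N := fun i => by
    rw [hN]; exact Finset.single_le_sum (fun j _ => (hmp j).le) (Finset.mem_univ i)
  have hN0 : 0 < N := (hmp i).trans_le (hmN i)
  have hu : ∀ i, p / m i < 1 := fun i => by rw [div_lt_one (hmp i)]; have := hm i; linarith
  have hu0 : ∀ i, 0 ≤ p / m i := fun i => div_nonneg hp.le (hmp i).le
  have hrho : ∀ i, 0 ≤ blrho (p / m i) := fun i => le_trans (by positivity) (blrho_ge _ (hu0 i) (hu i))
  have e : Real.log (1 - p / N) - ∑ i, (m i / N)^2 * Real.log (1 - p / m i)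
     = ∑ i, (m i / N)^2 * blrho (p / m i) - blrho (p / N) := by
    have e1 : ∑ i, (m i / N)^2 * blrho (p / m i) = -(∑ i, (m i / N)^2 * Real.log (1 - p / m i)) - ∑ i, m i * (p / N^2) := by
      rw [← Finset.sum_neg_distrib, ← Finset.sum_sub_distrib]
      refine Finset.sum_congr rfl fun i _ => ?_
      have := (hmp i).ne'
      unfold blrho; field_simp
    rw [e1, ← Finset.sum_mul, ← hN]
    unfold blrho; field_simp; ring
  rw [e]
  obtain ⟨j, hj⟩ : ∃ j : Fin k, j ≠ i := by
    have : Nontrivial (Fin k) := Fin.nontrivial_iff_two_le.2 hk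
    exact exists_ne i
  have h1 : (m i / N)^2 * blrho (p / m i) + (m j / N)^2 * blrho (p / m j) ≤ ∑ i, (m i / N)^2 * blrho (p / m i) := by
    rw [← Finset.sum_pair (f := fun i => (m i / N)^2 * blrho (p / m i)) hj.symm]
    exact Finset.sum_le_sum_of_subset_of_nonneg (Finset.subset_univ _) (fun l _ _ => mul_nonneg (by positivity) (hrho l))
  have h2 : blrho (p / N) ≤ (m j / N)^2 * blrho (p / m j) := by
    have := blrho_scale (m j / N) (p / m j) (div_nonneg (hmp j).le hN0.le) ((div_le_one hN0).2 (hmN j)) (hu0 j) (hu j)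
    have e : m j / N * (p / m j) = p / N := by have := (hmp j).ne'; field_simp
    rwa [e] at this
  have h3 : (p/N)^2 * blrho (p / m i) ≤ (m i / N)^2 * blrho (p / m i) := by
    apply mul_le_mul_of_nonneg_right _ (hrho i)
    have : p ≤ m i := by have := hm i; linarith
    gcongr
  linarith

/-- key lower bound -/
theorem blrho_dist (p m c : ℝ) (hp : 0 < p) (hm : p + 1 ≤ m) (hc : 0 < c) (hcu : c ≤ p / m) :
    min (Real.log p / 2 - 1) (c^2 * p / 2) ≤ blrho (p / m) * (m - p)^2 := by
  have hm0 : 0 < m := by linarith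
  have hu : p / m < 1 := by rw [div_lt_one hm0]; linarith
  have hu0 : 0 ≤ p / m := by positivity
  have h1 := blrho_ge _ hu0 hu
  have hd : 1 ≤ m - p := by linarith
  have hr0 : 0 ≤ blrho (p/m) := le_trans (by positivity) h1
  by_cases hcase : m ≤ (m - p)^2
  · refine (min_le_right _ _).trans ?_
    calc c^2 * p/2 ≤ (p/m)^2/2 * m := by
          have : c^2 ≤ (p/m)^2 := by gcongr
          have : p ≤ m := by linarith
          have : c^2 * p ≤ (p/m)^2 * m := by gcongr
          linarith
      _ ≤ _ := by gcongr
  · push Not at hcase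
    refine (min_le_left _ _).trans ?_
    have h2 : Real.log p / 2 - 1 ≤ blrho (p/m) := by
      unfold blrho
      have e : 1 - p/m = (m - p)/m := by field_simp
      rw [e, Real.log_div (by linarith) hm0.ne']
      have h3 := Real.log_le_log (by positivity) hcase.le
      rw [Real.log_pow] at h3
      have h4 := Real.log_le_log hp (show p ≤ m by linarith)
      push_cast at h3
      linarith
    have h5 : 1 ≤ (m-p)^2 := one_le_pow₀ hd
    exact h2.trans (le_mul_of_one_le_right hr0 h5)

theorem bl_group (h p m : ℝ) (hp : 0 ≤ p) (hm : p < m) :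
    h * (m * p / 2 * Real.log m) = blH (h*m/2) m - blH (h*m/2) (m - p)
      + h / 4 * (m * (2*m - 2*p - 1) * Real.log (1 - p/m)) + h^2 * m^2 / 4 * Real.log (1 - p/m)
      + h * p / 2 * m := by
  have hm0 : 0 < m := by linarith
  have e : 1 - p/m = (m - p)/m := by field_simp
  rw [e, Real.log_div (by linarith) hm0.ne']
  unfold blH
  ring

theorem bl_algebra {k : ℕ} (h p N μ σ : ℝ) (m : Fin k → ℝ) (hp : 0 ≤ p) (hm : ∀ i, p < m i) (hpN : p < N)
    (hN : N = ∑ i, m i)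
    (hμ : μ = (1/4) * (N * (2*N - 2*p - 1) * Real.log (1 - p/N) - ∑ i, m i * (2 * m i - 2*p - 1) * Real.log (1 - p / m i)))
    (hσ : σ = (1/2) * (Real.log (1 - p/N) - ∑ i, (m i / N)^2 * Real.log (1 - p/m i))) :
    h * (N * p / 2 * Real.log N - ∑ i, m i * p / 2 * Real.log (m i)) - h * μ
      + ∑ i, (blH (h * m i / 2) (m i) - blH (h * m i / 2) (m i - p)) - (blH (h*N/2) N - blH (h*N/2) (N-p))
      = h^2 * N^2 * σ / 2 := by
  have hN0 : N ≠ 0 := by linarith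
  have h1 : h * ∑ i, m i * p / 2 * Real.log (m i) = ∑ i, (blH (h * m i / 2) (m i) - blH (h * m i / 2) (m i - p))
      + h / 4 * ∑ i, m i * (2 * m i - 2*p - 1) * Real.log (1 - p / m i) + h^2 / 4 * ∑ i, (m i)^2 * Real.log (1 - p/m i)
      + h * p / 2 * N := by
    conv_rhs => rw [hN]
    rw [Finset.mul_sum, Finset.mul_sum, Finset.mul_sum, Finset.mul_sum, ← Finset.sum_add_distrib, ← Finset.sum_add_distrib, ← Finset.sum_add_distrib]
    refine Finset.sum_congr rfl fun i _ => ?_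
    rw [bl_group h p (m i) hp (hm i)]; ring
  have h2 := bl_group h p N hp hpN
  have h3 : N^2 * ∑ i, (m i / N)^2 * Real.log (1 - p/m i) = ∑ i, (m i)^2 * Real.log (1 - p/m i) := by
    rw [Finset.mul_sum]
    refine Finset.sum_congr rfl fun i _ => ?_
    field_simp
  rw [mul_sub, h1, h2, hμ, hσ]
  linear_combination (h^2/4) * h3

theorem bl_mgf (k p : ℕ) (hk : 1 ≤ k) (nn : Fin k → ℕ) (hn : ∀ i, p+1 < nn i) (N : ℕ)
    (hN : N = ∑ i, (nn i - 1)) (h T μ σ : ℝ)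
    (hμ : μ = (1/4) * (N * (2*N - 2*p - 1) * Real.log (1 - p/N) - ∑ i, ((nn i - 1 : ℕ):ℝ) * (2 * ((nn i - 1 : ℕ):ℝ) - 2*p - 1) * Real.log (1 - p / ((nn i - 1 : ℕ):ℝ))))
    (hσ : σ = (1/2) * (Real.log (1 - p/N) - ∑ i, (((nn i - 1 : ℕ):ℝ) / N)^2 * Real.log (1 - p/((nn i - 1 : ℕ):ℝ))))
    (hT : ∀ i, |h * ((nn i - 1 : ℕ):ℝ) / 2| ≤ T) (hTN : |h * N / 2| ≤ T)
    (h4 : ∀ i, |h * ((nn i - 1 : ℕ):ℝ) / 2| ≤ (((nn i - 1 : ℕ):ℝ) - p)/4) (h4N : |h * N / 2| ≤ ((N:ℝ) - p)/4) :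
    ∃ E : ℝ, |E| ≤ ∑ i, blK T * |h * ((nn i - 1 : ℕ):ℝ) / 2| / (((nn i - 1 : ℕ):ℝ) - p) + blK T * |h * N / 2| / ((N:ℝ) - p) ∧
      ∫⁻ ω, ENNReal.ofReal (Real.exp (h * (logBartlettStat k p nn ω - μ))) ∂(Measure.pi fun _ => gaussianReal 0 1)
        = ENNReal.ofReal (Real.exp (h^2 * N^2 * σ / 2 + E)) := by
  have hmp : ∀ i, p + 1 ≤ nn i - 1 := fun i => by have := hn i; omega
  have hmN : ∀ i, nn i - 1 ≤ N := fun i => by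
    rw [hN]; exact Finset.single_le_sum (f := fun i => nn i - 1) (fun _ _ => Nat.zero_le _) (Finset.mem_univ i)
  have hpN : p + 1 ≤ N := (hmp ⟨0, hk⟩).trans (hmN _)
  have key : ∀ m : ℕ, p + 1 ≤ m → ∀ t : ℝ, |t| ≤ ((m:ℝ) - p)/4 → ∀ c < p, 0 < ((m - c : ℕ):ℝ)/2 + t := by
    intro m hm t ht c hc
    have e : ((m - c : ℕ):ℝ) = (m:ℝ) - c := Nat.cast_sub (by omega)
    rw [e]
    have := (abs_le.1 ht).1
    have h1 : (c:ℝ) + 1 ≤ p := by exact_mod_cast hc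
    have h2 : (p:ℝ) + 1 ≤ m := by exact_mod_cast hm
    linarith
  have hCpos : ∀ m : ℕ, p + 1 ≤ m → ∀ t : ℝ, |t| ≤ ((m:ℝ) - p)/4 → ∀ c < p, 0 < blC (m - c) t := by
    intro m hm t ht c hc
    exact bl_blC_pos _ (by omega) _ (key m hm t ht c hc)
  have hmom := bl_stat_moment k p hk nn hn N hN h (fun c hc i => key _ (hmp i) _ (h4 i) c hc)
  set m : Fin k → ℕ := fun i => nn i - 1 with hmdef
  set S := ∑ i, ∑ c ∈ Finset.range p, Real.log (blC (m i - c) (h * (m i : ℝ)/2)) - ∑ c ∈ Finset.range p, Real.log (blC (N - c) (h*N/2)) with hS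
  have hprod : ∏ c ∈ Finset.range p, ((∏ i, blC (m i - c) (h*(m i:ℝ)/2)) / blC (N - c) (h*N/2)) = Real.exp S := by
    rw [hS, Finset.sum_comm, ← Finset.sum_sub_distrib, Real.exp_sum]
    refine Finset.prod_congr rfl fun c hc => ?_
    have hc := Finset.mem_range.1 hc
    rw [Real.exp_sub, Real.exp_sum, Real.exp_log (hCpos N hpN _ h4N c hc)]
    congr 1
    exact Finset.prod_congr rfl fun i _ => (Real.exp_log (hCpos (m i) (hmp i) _ (h4 i) c hc)).symm
  have halg := bl_algebra h p N μ σ (fun i => (m i : ℝ)) (Nat.cast_nonneg p)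
    (fun i => by exact_mod_cast hmp i) (by exact_mod_cast hpN) (by rw [hN]; push_cast; rfl) hμ hσ
  refine ⟨∑ i, (∑ c ∈ Finset.range p, Real.log (blC (m i - c) (h * (m i : ℝ)/2)) - (blH (h * m i / 2) (m i) - blH (h * m i / 2) (m i - p)))
    - (∑ c ∈ Finset.range p, Real.log (blC (N - c) (h*N/2)) - (blH (h*N/2) N - blH (h*N/2) (N-p))), ?_, ?_⟩
  · refine (abs_sub _ _).trans (add_le_add ?_ ?_)
    · refine (Finset.abs_sum_le_sum_abs _ _).trans (Finset.sum_le_sum fun i _ => ?_)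
      exact bl_s_sum T _ (m i) p (hmp i) (hT i) (h4 i)
    · exact bl_s_sum T _ N p hpN hTN h4N
  · have e : ∀ ω, ENNReal.ofReal (Real.exp (h * (logBartlettStat k p nn ω - μ)))
      = ENNReal.ofReal (Real.exp (-(h*μ))) * ENNReal.ofReal (Real.exp (h * logBartlettStat k p nn ω)) := by
      intro ω
      rw [← ENNReal.ofReal_mul (Real.exp_pos _).le, ← Real.exp_add]
      congr 2; ring
    simp_rw [e]
    rw [lintegral_const_mul' _ _ ENNReal.ofReal_ne_top, hmom, hprod, ← Real.exp_add, ← ENNReal.ofReal_mul (Real.exp_pos _).le, ← Real.exp_add]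
    congr 2
    rw [Finset.sum_sub_distrib, ← halg, hS]
    simp only [hmdef]
    ring

theorem bl_mgf_step (k p : ℕ) (hk : 1 ≤ k) (nn : Fin k → ℕ) (hn : ∀ i, p+1 < nn i) (N : ℕ)
    (hN : N = ∑ i, (nn i - 1)) (s ε T μ σ : ℝ)
    (hμ : μ = (1/4) * (N * (2*N - 2*p - 1) * Real.log (1 - p/N) - ∑ i, ((nn i - 1 : ℕ):ℝ) * (2 * ((nn i - 1 : ℕ):ℝ) - 2*p - 1) * Real.log (1 - p / ((nn i - 1 : ℕ):ℝ))))
    (hσ : σ = (1/2) * (Real.log (1 - p/N) - ∑ i, (((nn i - 1 : ℕ):ℝ) / N)^2 * Real.log (1 - p/((nn i - 1 : ℕ):ℝ))))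
    (hσ0 : 0 < σ) (hT : |s| / (2 * √σ) ≤ T) (hε : ∀ i, |s| / (2 * √σ) ≤ ε * (((nn i - 1 : ℕ):ℝ) - p))
    (hε0 : 0 ≤ ε) (hε4 : ε ≤ 1/4) :
    ∃ E : ℝ, |E| ≤ (k+1) * (blK T * ε) ∧
      ∫⁻ ω, ENNReal.ofReal (Real.exp (s * ((logBartlettStat k p nn ω - μ) / (N * √σ)))) ∂(Measure.pi fun _ => gaussianReal 0 1)
        = ENNReal.ofReal (Real.exp (s^2 / 2 + E)) := by
  have hmp : ∀ i, p + 1 ≤ nn i - 1 := fun i => by have := hn i; omega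
  have hmN : ∀ i, nn i - 1 ≤ N := fun i => by
    rw [hN]; exact Finset.single_le_sum (f := fun i => nn i - 1) (fun _ _ => Nat.zero_le _) (Finset.mem_univ i)
  have hpN : p + 1 ≤ N := (hmp ⟨0, hk⟩).trans (hmN _)
  have hmpR : ∀ i, (p:ℝ) + 1 ≤ ((nn i - 1 : ℕ):ℝ) := fun i => by exact_mod_cast hmp i
  have hmNR : ∀ i, ((nn i - 1 : ℕ):ℝ) ≤ N := fun i => by exact_mod_cast hmN i
  have hpNR : (p:ℝ) + 1 ≤ N := by exact_mod_cast hpN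
  have hp0 : (0:ℝ) ≤ p := Nat.cast_nonneg p
  have hN0 : (0:ℝ) < N := by linarith
  have hs : 0 < √σ := Real.sqrt_pos.2 hσ0
  set τ := |s| / (2 * √σ) with hτ
  have hτ0 : 0 ≤ τ := by positivity
  have hK : 0 ≤ blK T := by
    have : 0 ≤ T := hτ0.trans hT
    unfold blK; positivity
  set h := s / (N * √σ) with hh
  have ht : |h * N / 2| = τ := by
    rw [hh, hτ, abs_div, abs_mul, abs_div, abs_of_pos hN0, abs_of_pos (mul_pos hN0 hs), abs_of_pos (two_pos : (0:ℝ) < 2)]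
    field_simp
  have hti : ∀ i, |h * ((nn i - 1 : ℕ):ℝ) / 2| ≤ τ := by
    intro i
    rw [← ht, abs_div, abs_div, abs_mul, abs_mul, Nat.abs_cast, Nat.abs_cast]
    have := hmNR i
    gcongr
  have hεN : τ ≤ ε * ((N:ℝ) - p) := (hε ⟨0, hk⟩).trans (by have := hmNR ⟨0, hk⟩; gcongr)
  obtain ⟨E, hE, hI⟩ := bl_mgf k p hk nn hn N hN h T μ σ hμ hσ (fun i => (hti i).trans hT) (ht.le.trans hT)
    (fun i => by have h1 := hti i; have h2 := hε i; have h3 := hmpR i; nlinarith) (by rw [ht]; nlinarith)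
  refine ⟨E, hE.trans ?_, ?_⟩
  · have h1 : ∀ i, blK T * |h * ((nn i - 1 : ℕ):ℝ) / 2| / (((nn i - 1 : ℕ):ℝ) - p) ≤ blK T * ε := by
      intro i
      have h3 := hmpR i
      rw [mul_div_assoc]
      refine mul_le_mul_of_nonneg_left ?_ hK
      rw [div_le_iff₀ (by linarith)]
      exact (hti i).trans (hε i)
    have h2 : blK T * |h * N / 2| / ((N:ℝ) - p) ≤ blK T * ε := by
      rw [mul_div_assoc]
      refine mul_le_mul_of_nonneg_left ?_ hK
      rw [div_le_iff₀ (by linarith), ht]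
      exact hεN
    have h3 := Finset.sum_le_sum (fun i (_ : i ∈ (Finset.univ : Finset (Fin k))) => h1 i)
    rw [Finset.sum_const, Finset.card_univ, Fintype.card_fin, nsmul_eq_mul] at h3
    linarith
  · have e : ∀ ω, s * ((logBartlettStat k p nn ω - μ) / (N * √σ)) = h * (logBartlettStat k p nn ω - μ) := by
      intro ω; rw [hh]; ring
    simp_rw [e]
    rw [hI]
    congr 3
    rw [hh, div_pow, mul_pow, Real.sq_sqrt hσ0.le]
    field_simp

theorem bl_c_exists {k : ℕ} (nn : Fin k → ℕ → ℕ) (hnn : ∀ (i : Fin k) (p : ℕ), 1 ≤ p → p + 1 < nn i p)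
    (ys : Fin k → ℝ) (hys : ∀ i, ys i ∈ Set.Ioc (0 : ℝ) 1)
    (hlim : ∀ i, Tendsto (fun p : ℕ => (p : ℝ) / nn i p) atTop (𝓝 (ys i))) :
    ∃ c : ℝ, 0 < c ∧ ∀ᶠ p : ℕ in atTop, c * ∑ i, (nn i p : ℝ) ≤ p := by
  set C := ∑ i, (ys i)⁻¹ + 1 with hC
  have hC0 : 0 < C := by
    have : 0 ≤ ∑ i, (ys i)⁻¹ := Finset.sum_nonneg fun i _ => inv_nonneg.2 (hys i).1.le
    linarith
  have h1 : Tendsto (fun p : ℕ => ∑ i, ((p : ℝ) / nn i p)⁻¹) atTop (𝓝 (∑ i, (ys i)⁻¹)) :=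
    tendsto_finsetSum _ fun i _ => (hlim i).inv₀ (hys i).1.ne'
  refine ⟨C⁻¹, inv_pos.2 hC0, ?_⟩
  filter_upwards [h1.eventually_lt_const (show _ < C by rw [hC]; linarith), eventually_ge_atTop 1] with p hp h1p
  have hp0 : (0:ℝ) < p := by exact_mod_cast h1p
  simp_rw [inv_div, ← Finset.sum_div] at hp
  rw [div_lt_iff₀ hp0] at hp
  rw [inv_mul_le_iff₀ hC0]
  exact hp.le

theorem bl_eps_tendsto (c s : ℝ) (hc : 0 < c) :
    Tendsto (fun p : ℕ => |s| / (2 * √(c^2 * min (Real.log p / 2 - 1) (c^2 * p / 2) / 2))) atTop (𝓝 0) := by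
  have h1 : Tendsto (fun p : ℕ => min (Real.log p / 2 - 1) (c^2 * p / 2)) atTop atTop := by
    rw [tendsto_atTop]
    intro b
    have hl : Tendsto (fun p : ℕ => Real.log p / 2 - 1) atTop atTop :=
      tendsto_atTop_add_const_right _ _ ((Real.tendsto_log_atTop.comp tendsto_natCast_atTop_atTop).atTop_div_const two_pos)
    have hr : Tendsto (fun p : ℕ => c^2 * p / 2) atTop atTop :=
      (tendsto_natCast_atTop_atTop.const_mul_atTop (by positivity)).atTop_div_const two_pos
    filter_upwards [hl.eventually_ge_atTop b, hr.eventually_ge_atTop b] with p h1 h2 using le_min h1 h2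
  refine Tendsto.const_div_atTop ?_ _
  refine Tendsto.const_mul_atTop two_pos ?_
  refine Real.tendsto_sqrt_atTop.comp ?_
  exact (h1.const_mul_atTop (by positivity)).atTop_div_const two_pos

theorem bl_bounds {k : ℕ} (hk : 2 ≤ k) (m : Fin k → ℝ) (p N c s σ g : ℝ) (hp : 0 < p) (hm : ∀ i, p + 1 ≤ m i)
    (hN : N = ∑ i, m i) (hc : 0 < c) (hcN : c * N ≤ p) (hg : g = min (Real.log p / 2 - 1) (c^2 * p / 2)) (hg0 : 0 < g)
    (hσ : σ = (1/2) * (Real.log (1 - p/N) - ∑ i, (m i / N)^2 * Real.log (1 - p/m i))) :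
    |s| / (2 * √σ) ≤ |s| / c^2 ∧ ∀ i, |s| / (2 * √σ) ≤ |s| / (2 * √(c^2 * g / 2)) * (m i - p) := by
  have hmp : ∀ i, 0 < m i := fun i => by have := hm i; linarith
  have hmN : ∀ i, m i ≤ N := fun i => by
    rw [hN]; exact Finset.single_le_sum (fun j _ => (hmp j).le) (Finset.mem_univ i)
  have i0 : Fin k := ⟨0, by omega⟩
  have hN0 : 0 < N := (hmp i0).trans_le (hmN i0)
  have hcN2 : c ≤ p / N := by rwa [le_div_iff₀ hN0]
  have hcm : ∀ i, c ≤ p / m i := fun i => hcN2.trans (by have := hmN i; have := hmp i; gcongr)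
  have hrho : ∀ i, (p / m i)^2/2 ≤ blrho (p / m i) := fun i =>
    blrho_ge _ (div_nonneg hp.le (hmp i).le) (by rw [div_lt_one (hmp i)]; have := hm i; linarith)
  have hlow : ∀ i, c^2 * blrho (p / m i) ≤ 2 * σ := by
    intro i
    have h1 := bl_sigma_lower hk m p N hp hm hN i
    have h2 : c^2 * blrho (p / m i) ≤ (p/N)^2 * blrho (p / m i) := by
      have : 0 ≤ blrho (p / m i) := le_trans (by positivity) (hrho i)
      gcongr
    rw [hσ]; linarith
  constructor
  · have h1 : c^2 / 2 ≤ √σ := by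
      apply Real.le_sqrt_of_sq_le
      have h2 := hlow i0
      have h3 := hrho i0
      have h4 : c^2 ≤ (p / m i0)^2 := by have := hcm i0; gcongr
      have h5 : c^2 * (c^2/2) ≤ c^2 * blrho (p / m i0) := by gcongr; linarith
      nlinarith
    have : c^2 ≤ 2 * √σ := by linarith
    gcongr
  · intro i
    have hd : 0 < m i - p := by have := hm i; linarith
    have h1 := blrho_dist p (m i) c hp (hm i) hc (hcm i)
    rw [← hg] at h1
    have h2 : c^2 * g / 2 ≤ σ * (m i - p)^2 := by
      have h3 := mul_le_mul_of_nonneg_left h1 (sq_nonneg c)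
      have h4 := mul_le_mul_of_nonneg_right (hlow i) (sq_nonneg (m i - p))
      nlinarith
    have h3 : √(c^2 * g / 2) ≤ √σ * (m i - p) := by
      have := Real.sqrt_le_sqrt h2
      rwa [Real.sqrt_mul' _ (sq_nonneg _), Real.sqrt_sq hd.le] at this
    have h4 : 0 < √(c^2 * g / 2) := Real.sqrt_pos.2 (by positivity)
    have h5 : 0 < √σ := by
      by_contra hcon
      push Not at hcon
      nlinarith
    rw [div_mul_eq_mul_div, div_le_div_iff₀ (by positivity) (by positivity)]
    have := mul_le_mul_of_nonneg_left h3 (abs_nonneg s)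
    nlinarith

theorem stmt_9 (k : ℕ) (hk : 2 ≤ k) (nn : Fin k → ℕ → ℕ)
    (hnn : ∀ (i : Fin k) (p : ℕ), 1 ≤ p → p + 1 < nn i p)
    (ys : Fin k → ℝ) (hys : ∀ i, ys i ∈ Set.Ioc (0 : ℝ) 1)
    (hlim : ∀ i, Tendsto (fun p : ℕ => (p : ℝ) / nn i p) atTop (𝓝 (ys i)))
    (μn σsq : ℕ → ℝ)
    (hμ : ∀ p : ℕ, μn p = (1 / 4) *
      (((∑ i, (nn i p : ℝ)) - k) * (2 * (∑ i, (nn i p : ℝ)) - 2 * p - 2 * k - 1)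
          * Real.log (1 - (p : ℝ) / ((∑ i, (nn i p : ℝ)) - k))
        - ∑ i, ((nn i p : ℝ) - 1) * (2 * (nn i p : ℝ) - 2 * p - 3)
            * Real.log (1 - (p : ℝ) / ((nn i p : ℝ) - 1))))
    (hσ : ∀ p : ℕ, σsq p = (1 / 2) *
      (Real.log (1 - (p : ℝ) / ((∑ i, (nn i p : ℝ)) - k))
        - ∑ i, (((nn i p : ℝ) - 1) / ((∑ i, (nn i p : ℝ)) - k)) ^ 2
            * Real.log (1 - (p : ℝ) / ((nn i p : ℝ) - 1)))) :
    (∀ p : ℕ, 1 ≤ p → 0 < σsq p) ∧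
    ∀ f : BoundedContinuousFunction ℝ ℝ,
      Tendsto (fun p : ℕ =>
          ∫ ω : ((i : Fin k) × Fin (nn i p)) × Fin p → ℝ,
            f ((logBartlettStat k p (fun i => nn i p) ω - μn p)
              / (((∑ i, (nn i p : ℝ)) - k) * Real.sqrt (σsq p)))
            ∂(Measure.pi fun _ => gaussianReal 0 1))
        atTop (𝓝 (∫ x, f x ∂(gaussianReal 0 1))) := by
  have hm1 : ∀ i p, 1 ≤ p → ((nn i p - 1 : ℕ) : ℝ) = (nn i p : ℝ) - 1 := fun i p hp => by
    have := hnn i p hp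
    rw [Nat.cast_sub (by omega)]; simp
  have hNe : ∀ p, 1 ≤ p → ((∑ i, (nn i p - 1) : ℕ) : ℝ) = (∑ i, (nn i p : ℝ)) - k := fun p hp => by
    push_cast
    rw [Finset.sum_congr rfl fun i _ => hm1 i p hp]
    simp
  have hmp : ∀ (i : Fin k) (p : ℕ), 1 ≤ p → (p:ℝ) + 1 ≤ (nn i p : ℝ) - 1 := fun i p hp => by
    have := hnn i p hp
    rw [← hm1 i p hp]
    exact_mod_cast (by omega : p + 1 ≤ nn i p - 1)
  have hNs : ∀ p, (∑ i, (nn i p : ℝ)) - k = ∑ i, ((nn i p : ℝ) - 1) := fun p => by simp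
  have hpos : ∀ p : ℕ, 1 ≤ p → 0 < σsq p := by
    intro p hp
    have hp0 : (0:ℝ) < p := by exact_mod_cast hp
    have h1 := bl_sigma_lower hk (fun i => (nn i p : ℝ) - 1) p _ hp0 (fun i => hmp i p hp) (hNs p) ⟨0, by omega⟩
    have h0 : ∀ i, 0 < (nn i p : ℝ) - 1 := fun i => by have := hmp i p hp; linarith
    have hN0 : 0 < (∑ i, (nn i p : ℝ)) - k := by
      rw [hNs]
      exact Finset.sum_pos (fun i _ => h0 i) ⟨⟨0, by omega⟩, Finset.mem_univ _⟩
    have h2 := blrho_ge (p / ((nn ⟨0, by omega⟩ p : ℝ) - 1)) (div_nonneg hp0.le (h0 _).le)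
      (by rw [div_lt_one (h0 _)]; have := hmp ⟨0, by omega⟩ p hp; linarith)
    have h3 : 0 < ((p:ℝ) / ((nn ⟨0, by omega⟩ p : ℝ) - 1))^2/2 := by
      have := h0 ⟨0, by omega⟩
      positivity
    have h4 : 0 < ((p:ℝ) / ((∑ i, (nn i p : ℝ)) - k))^2 * blrho (p / ((nn ⟨0, by omega⟩ p : ℝ) - 1)) :=
      mul_pos (by positivity) (h3.trans_le h2)
    rw [hσ]
    have := h4.trans_le h1
    linarith
  refine ⟨hpos, ?_⟩
  set Z : (p : ℕ) → (((i : Fin k) × Fin (nn i p)) × Fin p → ℝ) → ℝ := fun p ω =>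
    (logBartlettStat k p (fun i => nn i p) ω - μn p) / (((∑ i, (nn i p : ℝ)) - k) * Real.sqrt (σsq p)) with hZ
  have hZm : ∀ p, Measurable (Z p) := fun p =>
    ((bl_stat_measurable k p fun i => nn i p).sub_const _).div_const _
  let P : ℕ → ProbabilityMeasure ℝ := fun p =>
    ⟨(Measure.pi fun _ => gaussianReal 0 1).map (Z p), Measure.isProbabilityMeasure_map (hZm p).aemeasurable⟩
  have hP : Tendsto P atTop (𝓝 ⟨gaussianReal 0 1, inferInstance⟩) := by
    apply bl_weak_of_mgf
    intro s
    obtain ⟨c, hc, hce⟩ := bl_c_exists nn hnn ys hys hlim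
    have hε := bl_eps_tendsto c s hc
    set g : ℕ → ℝ := fun p => min (Real.log p / 2 - 1) (c^2 * p / 2) with hg
    set ε : ℕ → ℝ := fun p => |s| / (2 * √(c^2 * g p / 2)) with hεd
    have hδ : Tendsto (fun p => ((k:ℝ)+1) * (blK (|s|/c^2) * ε p)) atTop (𝓝 0) := by
      have := (hε.const_mul (blK (|s|/c^2))).const_mul ((k:ℝ)+1)
      simpa using this
    have hgpos : ∀ᶠ p in atTop, 0 < g p := by
      have hl : Tendsto (fun p : ℕ => Real.log p / 2 - 1) atTop atTop :=
        tendsto_atTop_add_const_right _ _ ((Real.tendsto_log_atTop.comp tendsto_natCast_atTop_atTop).atTop_div_const two_pos)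
      filter_upwards [hl.eventually_gt_atTop 0, eventually_ge_atTop 1] with p h1 h2
      have hp0 : (0:ℝ) < p := by exact_mod_cast h2
      exact lt_min h1 (by positivity)
    have hb : ∀ᶠ p : ℕ in atTop, ∃ E : ℝ, |E| ≤ ((k:ℝ)+1) * (blK (|s|/c^2) * ε p) ∧
        ∫⁻ x, ENNReal.ofReal (Real.exp (s*x)) ∂(P p : Measure ℝ) = ENNReal.ofReal (Real.exp (s^2/2 + E)) := by
      filter_upwards [hce, hgpos, eventually_ge_atTop 1, hε.eventually_lt_const (show (0:ℝ) < 1/4 by norm_num)] with p h1 h2 h3 h4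
      have hp0 : (0:ℝ) < p := by exact_mod_cast h3
      obtain ⟨hb1, hb2⟩ := bl_bounds hk (fun i => (nn i p : ℝ) - 1) p _ c s (σsq p) (g p) hp0 (fun i => hmp i p h3) (hNs p) hc
        (by have : (0:ℝ) ≤ k := Nat.cast_nonneg k
            nlinarith) rfl h2 (hσ p)
      obtain ⟨E, hE, hI⟩ := bl_mgf_step k p (by omega) (fun i => nn i p) (fun i => hnn i p h3) _ rfl s (ε p) (|s|/c^2) (μn p) (σsq p)
        (by rw [hNe p h3, hμ p]
            congr 2
            · ring
            · refine Finset.sum_congr rfl fun i _ => ?_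
              rw [hm1 i p h3]; ring)
        (by rw [hNe p h3, hσ p]
            congr 2
            refine Finset.sum_congr rfl fun i _ => ?_
            rw [hm1 i p h3])
        (hpos p h3) hb1 (fun i => by rw [hm1 i p h3]; exact hb2 i) (by positivity) h4.le
      refine ⟨E, hE, ?_⟩
      rw [hNe p h3] at hI
      rw [← hI]
      exact lintegral_map (by fun_prop) (hZm p)
    have hcont : ∀ u : ℕ → ℝ, Tendsto u atTop (𝓝 0) →
        Tendsto (fun p => ENNReal.ofReal (Real.exp (s^2/2 + u p))) atTop (𝓝 (ENNReal.ofReal (Real.exp (s^2/2)))) := by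
      intro u hu
      have h1 : Tendsto (fun p => s^2/2 + u p) atTop (𝓝 (s^2/2)) := by simpa using hu.const_add (s^2/2)
      exact ENNReal.tendsto_ofReal ((Real.continuous_exp.tendsto _).comp h1)
    refine tendsto_of_tendsto_of_tendsto_of_le_of_le' (hcont _ (by simpa using hδ.neg)) (hcont _ hδ) ?_ ?_
    · filter_upwards [hb] with p hp
      obtain ⟨E, hE, hI⟩ := hp
      rw [hI]
      exact ENNReal.ofReal_le_ofReal (Real.exp_le_exp.2 (by have := (abs_le.1 hE).1; linarith))
    · filter_upwards [hb] with p hp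
      obtain ⟨E, hE, hI⟩ := hp
      rw [hI]
      exact ENNReal.ofReal_le_ofReal (Real.exp_le_exp.2 (by have := (abs_le.1 hE).2; linarith))
  intro f
  have h1 := (ProbabilityMeasure.tendsto_iff_forall_integral_tendsto.1 hP) f
  refine h1.congr fun p => ?_
  exact integral_map (hZm p).aemeasurable f.continuous.measurable.aestronglyMeasurable
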